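/- Let 0 < θ < 1, a ∈ ℝ, 0 < p < ∞, 0 < q₀, q₁, r ≤ ∞, and let q be defined by 1/q = (1−θ)/q₀ + θ/q₁. Let X₀ = HL^{a,r}_{p,q₀}(Ω) and X₁ = HL^{a,r}_{p,q₁}(Ω). Then the real interpolation space (X₀, X₁)_{θ,q} coincides with HL^{a,r}_{p,q}(Ω), with equivalent quasi-norms: there exist constants 0 < c ≤ C < ∞ such that for every f ∈ X₀ + X₁, c·‖f‖_{HL^{a,r}_{p,q}} ≤ ‖f‖_{(X₀,X₁)_{θ,q}} ≤ C·‖f‖_{HL^{a,r}_{p,q}}. -/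

import Mathlib

open MeasureTheory ENNReal Set Filter Topology

noncomputable section

variable {X : Type*}

/-- The decreasing rearrangement `f*` of `f` with respect to `μ` :
`f*(s) = inf {α ≥ 0 : μ({x : |f(x)| > α}) ≤ s}`. -/
def rearr [MeasurableSpace X] (μ : Measure X) (f : X → ℝ) (s : ℝ) : ℝ≥0∞ :=
  sInf {α : ℝ≥0∞ | μ {x | α < ENNReal.ofReal |f x|} ≤ ENNReal.ofReal s}

/-- The averaged (maximal) rearrangement `f**(s) = (1/s)∫_0^s f*(t) dt`. -/
def rearrStar [MeasurableSpace X] (μ : Measure X) (f : X → ℝ) (s : ℝ) : ℝ≥0∞ :=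
  (ENNReal.ofReal s)⁻¹ * ∫⁻ t in Set.Ioc (0 : ℝ) s, rearr μ f t

/-- The Lorentz functional built from a rearrangement-type function `R`:
`(∫_0^∞ (t^{1/p} R(t))^r dt/t)^{1/r}` for `r < ∞`, and `sup_{t>0} t^{1/p} R(t)`
for `r = ∞` (when `p = ∞`, `1/p` is interpreted as `0`, which for `R = f*`
recovers the essential supremum of `|f|`). -/
def lorentzNormOf (R : ℝ → ℝ≥0∞) (p r : ℝ≥0∞) : ℝ≥0∞ :=
  if r = ∞ then ⨆ t : {t : ℝ // 0 < t}, ENNReal.ofReal (t.1 ^ p.toReal⁻¹) * R t.1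
  else (∫⁻ t in Set.Ioi (0 : ℝ),
      (ENNReal.ofReal (t ^ p.toReal⁻¹) * R t) ^ r.toReal / ENNReal.ofReal t) ^ r.toReal⁻¹

/-- The Lorentz quasi-norm `‖f‖_{L^{p,r}}`. -/
def lorentzNorm [MeasurableSpace X] (μ : Measure X) (p r : ℝ≥0∞) (f : X → ℝ) : ℝ≥0∞ :=
  lorentzNormOf (rearr μ f) p r

/-- The Lorentz norm `‖f‖*_{L^{p,r}}`, with `f*` replaced by `f**`. -/
def lorentzNormStar [MeasurableSpace X] (μ : Measure X) (p r : ℝ≥0∞) (f : X → ℝ) : ℝ≥0∞ :=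
  lorentzNormOf (rearrStar μ f) p r

/-- The annuli `A_u`, `u ≥ -1`:  `A_{-1} = {x ∈ Ω : |x| < 1/2}` and, for `u ≥ 0`,
`A_u = {x ∈ Ω : 2^{u-1} ≤ |x| < 2^u}`. -/
def annulus [Norm X] (Ω : Set X) (u : ℤ) : Set X :=
  if u = -1 then {x ∈ Ω | ‖x‖ < 1 / 2}
  else {x ∈ Ω | (2 : ℝ) ^ (u - 1) ≤ ‖x‖ ∧ ‖x‖ < (2 : ℝ) ^ u}

/-- The Herz-type functional built from a functional `L` on the blocks:
`(Σ_{u ≥ -1} (2^{ua} L(f χ_{A_u}))^q)^{1/q}` for `q < ∞`, with the sup-modification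
for `q = ∞`. -/
def herzNormWith {E : Type*} [Norm X] [Zero E] (Ω : Set X) (a : ℝ) (q : ℝ≥0∞)
    (L : (X → E) → ℝ≥0∞) (f : X → E) : ℝ≥0∞ :=
  if q = ∞ then
    ⨆ u : {u : ℤ // -1 ≤ u},
      ENNReal.ofReal ((2 : ℝ) ^ ((u.1 : ℝ) * a)) * L ((annulus Ω u.1).indicator f)
  else (∑' u : {u : ℤ // -1 ≤ u},
      (ENNReal.ofReal ((2 : ℝ) ^ ((u.1 : ℝ) * a)) * L ((annulus Ω u.1).indicator f)) ^ q.toReal)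
      ^ q.toReal⁻¹

/-- The non-homogeneous Lorentz–Herz quasi-norm `‖f‖_{HL^{a,r}_{p,q}}`. -/
def herzNorm [MeasurableSpace X] [Norm X] (μ : Measure X) (Ω : Set X) (a : ℝ)
    (p q r : ℝ≥0∞) (f : X → ℝ) : ℝ≥0∞ :=
  herzNormWith Ω a q (lorentzNorm μ p r) f

/-- The non-homogeneous Lorentz–Herz norm `‖f‖*_{HL^{a,r}_{p,q}}`, built from the
Lorentz norms `‖·‖*_{L^{p,r}}`. -/
def herzNormStar [MeasurableSpace X] [Norm X] (μ : Measure X) (Ω : Set X) (a : ℝ)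
    (p q r : ℝ≥0∞) (f : X → ℝ) : ℝ≥0∞ :=
  herzNormWith Ω a q (lorentzNormStar μ p r) f

/-- The conjugate exponent: `1/p + 1/p' = 1`, with `1' = ∞` and `∞' = 1`. -/
def conjExp (p : ℝ≥0∞) : ℝ≥0∞ :=
  if p = 1 then ∞ else if p = ∞ then 1 else ENNReal.ofReal (p.toReal / (p.toReal - 1))

/-- The quantity `(Σ_{u≥-1} (2^{ua} μ(A_u ∩ E)^{1/p})^q)^{(of the summands)}`,
i.e. `Σ_{u≥-1} 2^{uaq} μ(A_u ∩ E)^{q/p}` for `q < ∞`, with the sup-modification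
for `q = ∞`. -/
def herzSetNorm [MeasurableSpace X] [Norm X] (μ : Measure X) (Ω : Set X) (a : ℝ)
    (p q : ℝ≥0∞) (E : Set X) : ℝ≥0∞ :=
  if q = ∞ then
    ⨆ u : {u : ℤ // -1 ≤ u},
      ENNReal.ofReal ((2 : ℝ) ^ ((u.1 : ℝ) * a)) * μ (annulus Ω u.1 ∩ E) ^ p.toReal⁻¹
  else ∑' u : {u : ℤ // -1 ≤ u},
      (ENNReal.ofReal ((2 : ℝ) ^ ((u.1 : ℝ) * a)) * μ (annulus Ω u.1 ∩ E) ^ p.toReal⁻¹) ^ q.toReal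

/-- The Peetre K-functional for the couple of quasi-normed function spaces
determined by the functionals `n₀`, `n₁`. -/
def Kfun [MeasurableSpace X] (n₀ n₁ : (X → ℝ) → ℝ≥0∞) (t : ℝ) (f : X → ℝ) : ℝ≥0∞ :=
  ⨅ (g : X → ℝ) (_ : Measurable g) (_ : Measurable (f - g)),
    n₀ g + ENNReal.ofReal t * n₁ (f - g)

/-- The real interpolation quasi-norm `‖f‖_{(X₀,X₁)_{θ,q}}`. -/
def interpNorm [MeasurableSpace X] (n₀ n₁ : (X → ℝ) → ℝ≥0∞) (θ : ℝ) (q : ℝ≥0∞)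
    (f : X → ℝ) : ℝ≥0∞ :=
  if q = ∞ then ⨆ t : {t : ℝ // 0 < t}, ENNReal.ofReal (t.1 ^ (-θ)) * Kfun n₀ n₁ t.1 f
  else (∫⁻ t in Set.Ioi (0 : ℝ),
      (ENNReal.ofReal (t ^ (-θ)) * Kfun n₀ n₁ t f) ^ q.toReal / ENNReal.ofReal t) ^ q.toReal⁻¹

/-- Membership in the sum `X₀ + X₁` of the couple determined by `n₀`, `n₁`. -/
def inSum [MeasurableSpace X] (n₀ n₁ : (X → ℝ) → ℝ≥0∞) (f : X → ℝ) : Prop :=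
  ∃ g : X → ℝ, Measurable g ∧ Measurable (f - g) ∧ n₀ g < ∞ ∧ n₁ (f - g) < ∞

end
abbrev Euc (N : ℕ) : Type := EuclideanSpace ℝ (Fin N)


/-! ### Part A: the Lorentz quasi-triangle inequality -/

lemma my_add_rpow_le (x y : ℝ≥0∞) {r : ℝ} (hr : 0 ≤ r) :
    (x + y) ^ r ≤ 2 ^ r * (x ^ r + y ^ r) := by
  have h1 : x + y ≤ 2 * max x y := by
    rw [two_mul]; exact add_le_add (le_max_left _ _) (le_max_right _ _)
  calc (x + y) ^ r ≤ (2 * max x y) ^ r := ENNReal.rpow_le_rpow h1 hr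
    _ = 2 ^ r * (max x y) ^ r := ENNReal.mul_rpow_of_nonneg _ _ hr
    _ ≤ _ := by
      gcongr
      rcases max_choice x y with h | h <;> rw [h]
      · exact le_self_add
      · exact le_add_self

lemma rearr_antitone {X : Type*} [MeasurableSpace X] (μ : Measure X) (f : X → ℝ) :
    Antitone (rearr μ f) := by
  intro s t hst
  unfold rearr
  apply sInf_le_sInf
  intro α hα
  exact le_trans hα (ENNReal.ofReal_le_ofReal hst)

lemma rearr_zero {X : Type*} [MeasurableSpace X] (μ : Measure X) (s : ℝ) :
    rearr μ (0 : X → ℝ) s = 0 := by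
  unfold rearr
  refine le_antisymm (sInf_le ?_) bot_le
  simp

lemma rearr_add {X : Type*} [MeasurableSpace X] (μ : Measure X) (g h : X → ℝ) (s : ℝ)
    (hs : 0 ≤ s) :
    rearr μ (g + h) s ≤ rearr μ g (s / 2) + rearr μ h (s / 2) := by
  unfold rearr
  rw [ENNReal.sInf_add]
  refine le_iInf₂ fun α hα => ?_
  rw [ENNReal.add_sInf]
  refine le_iInf₂ fun β hβ => ?_
  apply sInf_le
  simp only [mem_ofPred_eq] at hα hβ ⊢
  calc μ {x | α + β < ENNReal.ofReal |(g + h) x|}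
      ≤ μ ({x | α < ENNReal.ofReal |g x|} ∪ {x | β < ENNReal.ofReal |h x|}) := by
        apply measure_mono
        intro x hx
        by_contra hcon
        simp only [mem_union, mem_ofPred_eq, not_or, not_lt] at hcon hx
        refine absurd hx (not_lt.2 ?_)
        calc ENNReal.ofReal |(g + h) x| ≤ ENNReal.ofReal (|g x| + |h x|) :=
              ENNReal.ofReal_le_ofReal (abs_add_le _ _)
          _ = ENNReal.ofReal |g x| + ENNReal.ofReal |h x| :=
              ENNReal.ofReal_add (abs_nonneg _) (abs_nonneg _)
          _ ≤ _ := add_le_add hcon.1 hcon.2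
    _ ≤ _ := measure_union_le _ _
    _ ≤ ENNReal.ofReal (s / 2) + ENNReal.ofReal (s / 2) := add_le_add hα hβ
    _ = ENNReal.ofReal s := by
        rw [← ENNReal.ofReal_add (by positivity) (by positivity)]; congr 1; ring

lemma lorentzNorm_zero {X : Type*} [MeasurableSpace X] (μ : Measure X) (p r : ℝ≥0∞)
    (hr : 0 < r) : lorentzNorm μ p r (0 : X → ℝ) = 0 := by
  unfold lorentzNorm lorentzNormOf
  split_ifs with h
  · simp [rearr_zero]
  · have : 0 < r.toReal := ENNReal.toReal_pos hr.ne' h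
    simp [rearr_zero, this]

lemma lintegral_Ioi_two (g : ℝ → ℝ≥0∞) :
    ∫⁻ t in Ioi (0 : ℝ), g t = ∫⁻ t in Ioi (0 : ℝ), 2 * g (2 * t) := by
  have h := lintegral_image_eq_lintegral_abs_deriv_mul (s := Ioi (0 : ℝ))
    (f := fun x => 2 * x) (f' := fun _ => 2) measurableSet_Ioi
    (fun x _ => by simpa using ((hasDerivAt_id x).const_mul 2).hasDerivWithinAt)
    (fun x _ y _ hxy => by simpa using hxy) g
  have h2 : (fun x : ℝ => 2 * x) '' Ioi 0 = Ioi 0 := by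
    ext x
    simp only [mem_image, mem_Ioi]
    exact ⟨by rintro ⟨y, hy, rfl⟩; linarith, fun hx => ⟨x / 2, by linarith, by ring⟩⟩
  rw [h2] at h
  rw [h]
  simp

lemma lintegral_Ioi_inv (g : ℝ → ℝ≥0∞) :
    ∫⁻ t in Ioi (0 : ℝ), g t / ENNReal.ofReal t
      = ∫⁻ t in Ioi (0 : ℝ), g t⁻¹ / ENNReal.ofReal t := by
  have h := lintegral_image_eq_lintegral_abs_deriv_mul (s := Ioi (0 : ℝ))
    (f := fun x => x⁻¹) (f' := fun x => -(x ^ 2)⁻¹) measurableSet_Ioi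
    (fun x hx => (hasDerivAt_inv (ne_of_gt hx)).hasDerivWithinAt)
    (fun x _ y _ hxy => by simpa using hxy) (fun t => g t / ENNReal.ofReal t)
  have h2 : (fun x : ℝ => x⁻¹) '' Ioi 0 = Ioi 0 := by
    ext x
    simp only [mem_image, mem_Ioi]
    exact ⟨by rintro ⟨y, hy, rfl⟩; positivity, fun hx => ⟨x⁻¹, by positivity, by simp⟩⟩
  rw [h2] at h
  rw [h]
  refine setLIntegral_congr_fun measurableSet_Ioi fun t ht => ?_
  have ht' : (0 : ℝ) < t := ht
  rw [abs_neg, abs_of_pos (by positivity), ENNReal.ofReal_inv_of_pos (by positivity),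
    ENNReal.ofReal_inv_of_pos ht', ENNReal.ofReal_pow ht'.le, div_eq_mul_inv, div_eq_mul_inv,
    inv_inv, mul_comm, mul_assoc]
  congr 1
  have h0 : ENNReal.ofReal t ≠ 0 := by simpa using ht'
  rw [sq, ENNReal.mul_inv (Or.inl h0) (Or.inr h0), ← mul_assoc,
    ENNReal.mul_inv_cancel h0 ENNReal.ofReal_ne_top, one_mul]

lemma lorentzNormOf_add_le (p r : ℝ≥0∞) (hr : 0 < r) :
    ∃ κ : ℝ≥0∞, κ ≠ ∞ ∧ ∀ R R₁ R₂ : ℝ → ℝ≥0∞, Antitone R₁ → Antitone R₂ →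
      (∀ t, 0 < t → R t ≤ R₁ (t / 2) + R₂ (t / 2)) →
      lorentzNormOf R p r ≤ κ * (lorentzNormOf R₁ p r + lorentzNormOf R₂ p r) := by
  set e := p.toReal⁻¹ with he
  have he0 : 0 ≤ e := by positivity
  have key : ∀ t : ℝ, 0 < t →
      ENNReal.ofReal (t ^ e) = ENNReal.ofReal (2 ^ e) * ENNReal.ofReal ((t / 2) ^ e) := by
    intro t ht
    rw [← ENNReal.ofReal_mul (by positivity), ← Real.mul_rpow (by positivity) (by positivity)]
    congr 2; ring
  by_cases hrt : r = ∞
  · refine ⟨ENNReal.ofReal (2 ^ e), ENNReal.ofReal_ne_top, ?_⟩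
    intro R R₁ R₂ _ _ h
    simp only [lorentzNormOf, hrt, if_true]
    refine iSup_le fun t => ?_
    have ht := t.2
    have ht2 : 0 < t.1 / 2 := by linarith
    calc ENNReal.ofReal (t.1 ^ e) * R t.1
        ≤ ENNReal.ofReal (t.1 ^ e) * (R₁ (t.1 / 2) + R₂ (t.1 / 2)) := by gcongr; exact h _ ht
      _ = ENNReal.ofReal (2 ^ e) * (ENNReal.ofReal ((t.1 / 2) ^ e) * R₁ (t.1 / 2) +
            ENNReal.ofReal ((t.1 / 2) ^ e) * R₂ (t.1 / 2)) := by
          rw [key _ ht]; ring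
      _ ≤ _ := by
          gcongr
          · exact le_iSup (fun t : {t : ℝ // 0 < t} => ENNReal.ofReal (t.1 ^ e) * R₁ t.1)
              ⟨t.1 / 2, ht2⟩
          · exact le_iSup (fun t : {t : ℝ // 0 < t} => ENNReal.ofReal (t.1 ^ e) * R₂ t.1)
              ⟨t.1 / 2, ht2⟩
  · have hr0 : 0 < r.toReal := ENNReal.toReal_pos hr.ne' hrt
    set ρ := r.toReal with hρ
    set A : ℝ≥0∞ := 2 ^ ρ * ENNReal.ofReal (2 ^ e) ^ ρ with hA
    have hAt : A ≠ ∞ := by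
      apply ENNReal.mul_ne_top
      · exact ENNReal.rpow_ne_top_of_nonneg hr0.le (by simp)
      · exact ENNReal.rpow_ne_top_of_nonneg hr0.le (by simp)
    refine ⟨A ^ ρ⁻¹ * 2 ^ ρ⁻¹, ?_, ?_⟩
    · apply ENNReal.mul_ne_top
      · exact ENNReal.rpow_ne_top_of_nonneg (by positivity) hAt
      · exact ENNReal.rpow_ne_top_of_nonneg (by positivity) (by simp)
    intro R R₁ R₂ hR₁ hR₂ h
    simp only [lorentzNormOf, hrt, if_false]
    rw [← hρ, ← he]
    set I₁ := ∫⁻ t in Ioi (0 : ℝ), (ENNReal.ofReal (t ^ e) * R₁ t) ^ ρ / ENNReal.ofReal t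
    set I₂ := ∫⁻ t in Ioi (0 : ℝ), (ENNReal.ofReal (t ^ e) * R₂ t) ^ ρ / ENNReal.ofReal t
    have main : ∫⁻ t in Ioi (0 : ℝ), (ENNReal.ofReal (t ^ e) * R t) ^ ρ / ENNReal.ofReal t
        ≤ A * (I₁ + I₂) := by
      have hm : Measurable fun t : ℝ =>
          (ENNReal.ofReal (t ^ e) * R₁ t) ^ ρ / ENNReal.ofReal t := by
        have := hR₁.measurable
        fun_prop
      rw [← lintegral_add_left hm, ← lintegral_const_mul' _ _ hAt, lintegral_Ioi_two]
      refine setLIntegral_mono' measurableSet_Ioi fun t ht => ?_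
      have ht' : (0 : ℝ) < t := ht
      have h2t : 0 < 2 * t := by linarith
      have hdiv : ∀ x : ℝ≥0∞, 2 * (x / ENNReal.ofReal (2 * t)) = x / ENNReal.ofReal t := by
        intro x
        rw [ENNReal.ofReal_mul (by norm_num), div_eq_mul_inv, div_eq_mul_inv,
          ENNReal.mul_inv (by simp) (by simp)]
        rw [show (2 : ℝ≥0∞) * (x * ((ENNReal.ofReal 2)⁻¹ * (ENNReal.ofReal t)⁻¹))
          = (2 * (ENNReal.ofReal 2)⁻¹) * (x * (ENNReal.ofReal t)⁻¹) by ring]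
        rw [show ENNReal.ofReal 2 = 2 by simp, ENNReal.mul_inv_cancel (by simp) (by simp), one_mul]
      rw [hdiv, ← ENNReal.add_div, ← mul_div_assoc]
      gcongr
      have h3 := h _ h2t
      rw [show 2 * t / 2 = t by ring] at h3
      calc (ENNReal.ofReal ((2 * t) ^ e) * R (2 * t)) ^ ρ
          ≤ (ENNReal.ofReal (2 ^ e) *
              (ENNReal.ofReal (t ^ e) * R₁ t + ENNReal.ofReal (t ^ e) * R₂ t)) ^ ρ := by
            apply ENNReal.rpow_le_rpow _ hr0.le
            rw [key _ h2t, show 2 * t / 2 = t by ring, ← mul_add, mul_assoc]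
            gcongr
        _ = ENNReal.ofReal (2 ^ e) ^ ρ *
              (ENNReal.ofReal (t ^ e) * R₁ t + ENNReal.ofReal (t ^ e) * R₂ t) ^ ρ :=
            ENNReal.mul_rpow_of_nonneg _ _ hr0.le
        _ ≤ ENNReal.ofReal (2 ^ e) ^ ρ * (2 ^ ρ * ((ENNReal.ofReal (t ^ e) * R₁ t) ^ ρ +
              (ENNReal.ofReal (t ^ e) * R₂ t) ^ ρ)) := by
            gcongr; exact my_add_rpow_le _ _ hr0.le
        _ = _ := by rw [hA]; ring
    calc _ ≤ (A * (I₁ + I₂)) ^ ρ⁻¹ := ENNReal.rpow_le_rpow main (by positivity)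
      _ = A ^ ρ⁻¹ * (I₁ + I₂) ^ ρ⁻¹ := ENNReal.mul_rpow_of_nonneg _ _ (by positivity)
      _ ≤ A ^ ρ⁻¹ * (2 ^ ρ⁻¹ * (I₁ ^ ρ⁻¹ + I₂ ^ ρ⁻¹)) := by
          gcongr; exact my_add_rpow_le _ _ (by positivity)
      _ = _ := by ring

lemma lorentzNorm_add_le {X : Type*} [MeasurableSpace X] (μ : Measure X) (p r : ℝ≥0∞)
    (hr : 0 < r) :
    ∃ κ : ℝ≥0∞, κ ≠ ∞ ∧ ∀ g h : X → ℝ,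
      lorentzNorm μ p r (g + h) ≤ κ * (lorentzNorm μ p r g + lorentzNorm μ p r h) := by
  obtain ⟨κ, hκ, H⟩ := lorentzNormOf_add_le p r hr
  exact ⟨κ, hκ, fun g h => H _ _ _ (rearr_antitone μ g) (rearr_antitone μ h)
    fun t ht => rearr_add μ g h t ht.le⟩


/-! ### Part B: reduction to scalar sequences -/

/-- The `ℓ^q` quasi-norm of a sequence. -/
noncomputable def seqNorm {ι : Type*} (q : ℝ≥0∞) (b : ι → ℝ≥0∞) : ℝ≥0∞ :=
  if q = ∞ then ⨆ u, b u else (∑' u, b u ^ q.toReal) ^ q.toReal⁻¹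

/-- The K-functional of scalar sequences, restricted to splittings by index sets. -/
noncomputable def seqK {ι : Type*} (q₀ q₁ : ℝ≥0∞) (b : ι → ℝ≥0∞) (t : ℝ) : ℝ≥0∞ :=
  ⨅ S : Set ι, seqNorm q₀ (S.indicator b) + ENNReal.ofReal t * seqNorm q₁ (Sᶜ.indicator b)

/-- The interpolation functional applied to a function of `t`. -/
noncomputable def interpOf (K : ℝ → ℝ≥0∞) (θ : ℝ) (q : ℝ≥0∞) : ℝ≥0∞ :=
  if q = ∞ then ⨆ t : {t : ℝ // 0 < t}, ENNReal.ofReal (t.1 ^ (-θ)) * K t.1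
  else (∫⁻ t in Set.Ioi (0 : ℝ),
      (ENNReal.ofReal (t ^ (-θ)) * K t) ^ q.toReal / ENNReal.ofReal t) ^ q.toReal⁻¹

lemma seqNorm_mono {ι : Type*} (q : ℝ≥0∞) {b c : ι → ℝ≥0∞} (h : ∀ u, b u ≤ c u) :
    seqNorm q b ≤ seqNorm q c := by
  unfold seqNorm
  split_ifs
  · exact iSup_mono h
  · refine ENNReal.rpow_le_rpow (ENNReal.tsum_le_tsum fun u => ?_) (by positivity)
    exact ENNReal.rpow_le_rpow (h u) (by positivity)

lemma seqNorm_const_mul {ι : Type*} (q : ℝ≥0∞) (hq : 0 < q) (C : ℝ≥0∞) (b : ι → ℝ≥0∞) :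
    seqNorm q (fun u => C * b u) = C * seqNorm q b := by
  unfold seqNorm
  split_ifs with h
  · rw [ENNReal.mul_iSup]
  · have h0 : 0 < q.toReal := ENNReal.toReal_pos hq.ne' h
    simp_rw [ENNReal.mul_rpow_of_nonneg _ _ h0.le]
    rw [ENNReal.tsum_mul_left, ENNReal.mul_rpow_of_nonneg _ _ (by positivity),
      ← ENNReal.rpow_mul, mul_inv_cancel₀ h0.ne', ENNReal.rpow_one]

lemma le_seqNorm {ι : Type*} (q : ℝ≥0∞) (hq : 0 < q) (b : ι → ℝ≥0∞) (u : ι) :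
    b u ≤ seqNorm q b := by
  unfold seqNorm
  split_ifs with h
  · exact le_iSup b u
  · have h0 : 0 < q.toReal := ENNReal.toReal_pos hq.ne' h
    calc b u = (b u ^ q.toReal) ^ q.toReal⁻¹ := by
          rw [← ENNReal.rpow_mul, mul_inv_cancel₀ h0.ne', ENNReal.rpow_one]
      _ ≤ _ := ENNReal.rpow_le_rpow (ENNReal.le_tsum u) (by positivity)

lemma interpOf_mono {K K' : ℝ → ℝ≥0∞} (θ : ℝ) (q : ℝ≥0∞) (h : ∀ t, 0 < t → K t ≤ K' t) :
    interpOf K θ q ≤ interpOf K' θ q := by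
  unfold interpOf
  split_ifs
  · refine iSup_mono fun t => ?_
    gcongr
    exact h _ t.2
  · refine ENNReal.rpow_le_rpow (setLIntegral_mono' measurableSet_Ioi fun t ht => ?_)
      (by positivity)
    gcongr
    exact h _ ht

lemma interpOf_const_mul (K : ℝ → ℝ≥0∞) (θ : ℝ) (q : ℝ≥0∞) (hq : 0 < q) (C : ℝ≥0∞)
    (hC : C ≠ ∞) : interpOf (fun t => C * K t) θ q = C * interpOf K θ q := by
  unfold interpOf
  split_ifs with h
  · rw [ENNReal.mul_iSup]
    congr 1; ext t; ring
  · have h0 : 0 < q.toReal := ENNReal.toReal_pos hq.ne' h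
    have : ∀ t : ℝ, (ENNReal.ofReal (t ^ (-θ)) * (C * K t)) ^ q.toReal / ENNReal.ofReal t
        = C ^ q.toReal * ((ENNReal.ofReal (t ^ (-θ)) * K t) ^ q.toReal / ENNReal.ofReal t) := by
      intro t
      rw [← mul_div_assoc, ← ENNReal.mul_rpow_of_nonneg _ _ h0.le]
      congr 2; ring
    simp_rw [this]
    rw [lintegral_const_mul' _ _ (ENNReal.rpow_ne_top_of_nonneg h0.le hC),
      ENNReal.mul_rpow_of_nonneg _ _ (by positivity),
      ← ENNReal.rpow_mul, mul_inv_cancel₀ h0.ne', ENNReal.rpow_one]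

lemma annulus_eq_of_mem {X : Type*} [Norm X] (Ω : Set X) {u v : ℤ} (hu : -1 ≤ u) (hv : -1 ≤ v)
    {x : X} (hxu : x ∈ annulus Ω u) (hxv : x ∈ annulus Ω v) : u = v := by
  have aux : ∀ w : ℤ, -1 ≤ w → x ∈ annulus Ω w →
      ‖x‖ < (2 : ℝ) ^ w ∧ (w ≠ -1 → (2 : ℝ) ^ (w - 1) ≤ ‖x‖) := by
    intro w _ hx
    unfold annulus at hx
    split_ifs at hx with h
    · refine ⟨?_, fun h' => absurd h h'⟩
      rw [h]
      have := hx.2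
      norm_num at this ⊢
      exact this
    · exact ⟨hx.2.2, fun _ => hx.2.1⟩
  have key : ∀ w z : ℤ, -1 ≤ w → -1 ≤ z → x ∈ annulus Ω w → x ∈ annulus Ω z → w ≤ z := by
    intro w z hw hz hxw hxz
    by_cases h : w = -1
    · omega
    · have h1 := (aux w hw hxw).2 h
      have h2 := (aux z hz hxz).1
      have h3 : (2 : ℝ) ^ (w - 1) < 2 ^ z := lt_of_le_of_lt h1 h2
      rw [zpow_lt_zpow_iff_right₀ (by norm_num)] at h3
      omega
  exact le_antisymm (key u v hu hv hxu hxv) (key v u hv hu hxv hxu)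

lemma annulus_measurable {N : ℕ} {Ω : Set (Euc N)} (hΩ : MeasurableSet Ω) (u : ℤ) :
    MeasurableSet (annulus Ω u) := by
  unfold annulus
  split_ifs
  · exact hΩ.inter (measurableSet_lt measurable_norm measurable_const)
  · exact hΩ.inter ((measurableSet_le measurable_const measurable_norm).inter
      (measurableSet_lt measurable_norm measurable_const))

/-- The block sequence of `f`. -/
noncomputable def blk {N : ℕ} (Ω : Set (Euc N)) (a : ℝ) (p r : ℝ≥0∞) (f : Euc N → ℝ)
    (u : {u : ℤ // -1 ≤ u}) : ℝ≥0∞ :=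
  ENNReal.ofReal ((2 : ℝ) ^ ((u.1 : ℝ) * a)) *
    lorentzNorm volume p r ((annulus Ω u.1).indicator f)

lemma herzNorm_eq {N : ℕ} (Ω : Set (Euc N)) (a : ℝ) (p q r : ℝ≥0∞) (f : Euc N → ℝ) :
    herzNorm volume Ω a p q r f = seqNorm q (blk Ω a p r f) := rfl

lemma interpNorm_eq {X : Type*} [MeasurableSpace X] (n₀ n₁ : (X → ℝ) → ℝ≥0∞) (θ : ℝ) (q : ℝ≥0∞)
    (f : X → ℝ) : interpNorm n₀ n₁ θ q f = interpOf (fun t => Kfun n₀ n₁ t f) θ q := rfl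

lemma Kfun_le_seqK {N : ℕ} {Ω : Set (Euc N)} (hΩ : MeasurableSet Ω) (a : ℝ)
    (p q₀ q₁ r : ℝ≥0∞) (hr : 0 < r) (f : Euc N → ℝ) (hf : Measurable f) (t : ℝ) :
    Kfun (herzNorm volume Ω a p q₀ r) (herzNorm volume Ω a p q₁ r) t f
      ≤ seqK q₀ q₁ (blk Ω a p r f) t := by
  unfold seqK
  refine le_iInf fun S => ?_
  set E : Set (Euc N) := ⋃ u ∈ S, annulus Ω u.1 with hE
  have hEm : MeasurableSet E :=
    MeasurableSet.biUnion (Set.to_countable S) fun u _ => annulus_measurable hΩ u.1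
  have hg : Measurable (E.indicator f) := hf.indicator hEm
  unfold Kfun
  refine iInf_le_of_le (E.indicator f) ?_
  refine iInf_le_of_le hg ?_
  refine iInf_le_of_le (hf.sub hg) ?_
  have hin : ∀ u ∈ S, annulus Ω u.1 ⊆ E := fun u hu =>
    Set.subset_biUnion_of_mem (u := fun u : {u : ℤ // -1 ≤ u} => annulus Ω u.1) hu
  have hout : ∀ u ∉ S, ∀ x ∈ annulus Ω u.1, x ∉ E := by
    intro u hu x hx hxE
    simp only [hE, mem_iUnion] at hxE
    obtain ⟨v, hv, hxv⟩ := hxE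
    have : u = v := Subtype.ext (annulus_eq_of_mem Ω u.2 v.2 hx hxv)
    exact hu (this ▸ hv)
  rw [herzNorm_eq, herzNorm_eq]
  gcongr ?_ + _ * ?_
  · apply seqNorm_mono
    intro u
    by_cases hu : u ∈ S
    · rw [Set.indicator_of_mem hu]
      unfold blk
      rw [Set.indicator_indicator, Set.inter_eq_left.2 (hin u hu)]
    · rw [Set.indicator_of_notMem hu]
      unfold blk
      have : (annulus Ω u.1).indicator (E.indicator f) = 0 := by
        rw [Set.indicator_indicator]
        have : annulus Ω u.1 ∩ E = ∅ := by
          ext x; simp only [mem_inter_iff, mem_empty_iff_false, iff_false, not_and]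
          exact hout u hu x
        rw [this, Set.indicator_empty]; rfl
      rw [this, lorentzNorm_zero _ _ _ hr, mul_zero]
  · apply seqNorm_mono
    intro u
    by_cases hu : u ∈ S
    · rw [Set.indicator_of_notMem (by simpa using hu)]
      unfold blk
      have : (annulus Ω u.1).indicator (f - E.indicator f) = 0 := by
        ext x
        by_cases hx : x ∈ annulus Ω u.1
        · simp [Set.indicator_of_mem hx, Set.indicator_of_mem (hin u hu hx)]
        · simp [hx]
      rw [this, lorentzNorm_zero _ _ _ hr, mul_zero]
    · rw [Set.indicator_of_mem (by simpa using hu)]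
      unfold blk
      have : (annulus Ω u.1).indicator (f - E.indicator f) = (annulus Ω u.1).indicator f := by
        ext x
        by_cases hx : x ∈ annulus Ω u.1
        · simp [Set.indicator_of_mem hx, Set.indicator_of_notMem (hout u hu x hx)]
        · simp [hx]
      rw [this]

lemma seqK_le_Kfun {N : ℕ} (Ω : Set (Euc N)) (a : ℝ)
    (p q₀ q₁ r : ℝ≥0∞) (hq₀ : 0 < q₀) (hq₁ : 0 < q₁) (hr : 0 < r) :
    ∃ κ : ℝ≥0∞, κ ≠ ∞ ∧ κ ≠ 0 ∧ ∀ (f : Euc N → ℝ) (t : ℝ),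
      seqK q₀ q₁ (blk Ω a p r f) t ≤
        κ * Kfun (herzNorm volume Ω a p q₀ r) (herzNorm volume Ω a p q₁ r) t f := by
  obtain ⟨κ, hκ, H⟩ := lorentzNorm_add_le (volume : Measure (Euc N)) p r hr
  have hM : (κ + 1) * 2 ≠ ∞ := ENNReal.mul_ne_top (by simp [hκ]) (by simp)
  have hM0 : (κ + 1) * 2 ≠ 0 := by simp
  refine ⟨(κ + 1) * 2, hM, hM0, fun f t => ?_⟩
  unfold Kfun
  simp only [ENNReal.mul_iInf_of_ne hM0 hM]
  refine le_iInf fun g => le_iInf fun _ => le_iInf fun _ => ?_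
  set h := f - g with hh
  have hadd : ∀ u, blk Ω a p r f u ≤ (κ + 1) * (blk Ω a p r g u + blk Ω a p r h u) := by
    intro u
    unfold blk
    have e : (annulus Ω u.1).indicator f
        = (annulus Ω u.1).indicator g + (annulus Ω u.1).indicator h := by
      rw [← Set.indicator_add', hh, add_sub_cancel]
    rw [e, ← mul_add, mul_left_comm]
    gcongr
    refine (H _ _).trans ?_
    gcongr
    exact le_self_add
  set S : Set {u : ℤ // -1 ≤ u} := {u | blk Ω a p r h u ≤ blk Ω a p r g u} with hS
  refine (iInf_le _ S).trans ?_
  rw [herzNorm_eq, herzNorm_eq, mul_add, mul_left_comm]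
  rw [← seqNorm_const_mul _ hq₀ ((κ + 1) * 2), ← seqNorm_const_mul _ hq₁ ((κ + 1) * 2)]
  gcongr ?_ + _ * ?_
  · apply seqNorm_mono
    intro u
    by_cases hu : u ∈ S
    · rw [Set.indicator_of_mem hu]
      refine (hadd u).trans ?_
      rw [mul_assoc, two_mul]
      gcongr
      exact hu
    · rw [Set.indicator_of_notMem hu]; exact bot_le
  · apply seqNorm_mono
    intro u
    by_cases hu : u ∈ S
    · rw [Set.indicator_of_notMem (by simpa using hu)]; exact bot_le
    · rw [Set.indicator_of_mem (by simpa using hu)]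
      refine (hadd u).trans ?_
      rw [mul_assoc, two_mul]
      gcongr
      have : ¬ (blk Ω a p r h u ≤ blk Ω a p r g u) := hu
      exact (not_le.1 this).le


/-! ### Part C: discretisation of the interpolation integral -/

/-- The integrand of the interpolation functional. -/
noncomputable def itg (K : ℝ → ℝ≥0∞) (θ Q : ℝ) (t : ℝ) : ℝ≥0∞ :=
  (ENNReal.ofReal (t ^ (-θ)) * K t) ^ Q / ENNReal.ofReal t

lemma itg_lower (K : ℝ → ℝ≥0∞) {θ Q ρ A M : ℝ} (hθ : 0 < θ) (hQ : 0 < Q) (hρ : 1 < ρ)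
    (hA : 0 < A) (hM : 0 ≤ M) (hK : ∀ t, A ≤ t → ENNReal.ofReal M ≤ K t) :
    ENNReal.ofReal ((ρ * A) ^ (-(θ * Q)) * M ^ Q * (1 - ρ⁻¹))
      ≤ ∫⁻ t in Ioc A (ρ * A), itg K θ Q t := by
  have hρ0 : 0 < ρ := by linarith
  have hρA : 0 < ρ * A := by positivity
  have h1 : ∀ t ∈ Ioc A (ρ * A),
      ENNReal.ofReal (((ρ * A) ^ (-θ) * M) ^ Q / (ρ * A)) ≤ itg K θ Q t := by
    intro t ht
    have ht0 : 0 < t := hA.trans ht.1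
    unfold itg
    rw [ENNReal.ofReal_div_of_pos hρA,
      ← ENNReal.ofReal_rpow_of_nonneg (by positivity) hQ.le, ENNReal.ofReal_mul (by positivity)]
    have e1 : (ρ * A) ^ (-θ) ≤ t ^ (-θ) :=
      Real.rpow_le_rpow_of_nonpos ht0 ht.2 (by linarith)
    have e2 := hK t ht.1.le
    have e3 := ht.2
    gcongr
  calc _ = ENNReal.ofReal (((ρ * A) ^ (-θ) * M) ^ Q / (ρ * A)) * volume (Ioc A (ρ * A)) := by
        rw [Real.volume_Ioc, ← ENNReal.ofReal_mul (by positivity)]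
        congr 1
        rw [Real.mul_rpow (by positivity) hM, ← Real.rpow_mul hρA.le]
        rw [neg_mul]
        field_simp
    _ = ∫⁻ _ in Ioc A (ρ * A), ENNReal.ofReal (((ρ * A) ^ (-θ) * M) ^ Q / (ρ * A)) := by
        rw [setLIntegral_const]
    _ ≤ _ := setLIntegral_mono' measurableSet_Ioc h1

lemma itg_upper (K : ℝ → ℝ≥0∞) {θ Q A B D : ℝ} (hθ : θ < 1) (hQ : 0 < Q)
    (hA : 0 ≤ A) (hB : 0 ≤ B) (hD : 0 ≤ D)
    (hK : ∀ t, A < t → t ≤ B → K t ≤ ENNReal.ofReal (D * t)) :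
    ∫⁻ t in Ioc A B, itg K θ Q t
      ≤ ENNReal.ofReal (D ^ Q * B ^ ((1 - θ) * Q) * ((1 - θ) * Q)⁻¹) := by
  have hs : 0 < (1 - θ) * Q := mul_pos (by linarith) hQ
  have h1 : ∀ t ∈ Ioc A B, itg K θ Q t ≤ ENNReal.ofReal (D ^ Q * t ^ ((1 - θ) * Q - 1)) := by
    intro t ht
    have ht0 : 0 < t := lt_of_le_of_lt hA ht.1
    unfold itg
    calc _ ≤ (ENNReal.ofReal (t ^ (-θ)) * ENNReal.ofReal (D * t)) ^ Q / ENNReal.ofReal t := by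
          gcongr
          exact hK t ht.1 ht.2
      _ = _ := by
          rw [← ENNReal.ofReal_mul (by positivity),
            ENNReal.ofReal_rpow_of_nonneg (by positivity) hQ.le, ← ENNReal.ofReal_div_of_pos ht0]
          congr 1
          rw [show t ^ (-θ) * (D * t) = D * t ^ (1 - θ) by
            rw [show (1 - θ) = -θ + 1 by ring, Real.rpow_add ht0, Real.rpow_one]; ring]
          rw [Real.mul_rpow hD (by positivity), ← Real.rpow_mul ht0.le, Real.rpow_sub ht0,
            Real.rpow_one, mul_div_assoc]
  calc _ ≤ ∫⁻ t in Ioc A B, ENNReal.ofReal (D ^ Q * t ^ ((1 - θ) * Q - 1)) :=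
        setLIntegral_mono' measurableSet_Ioc h1
    _ ≤ ∫⁻ t in Ioc 0 B, ENNReal.ofReal (D ^ Q * t ^ ((1 - θ) * Q - 1)) :=
        lintegral_mono_set (Ioc_subset_Ioc_left hA)
    _ = ENNReal.ofReal (∫ t in Ioc 0 B, D ^ Q * t ^ ((1 - θ) * Q - 1)) := by
        rw [ofReal_integral_eq_lintegral_ofReal]
        · apply Integrable.const_mul
          have := intervalIntegral.intervalIntegrable_rpow' (a := 0) (b := B)
            (r := (1 - θ) * Q - 1) (by linarith)
          rw [intervalIntegrable_iff_integrableOn_Ioc_of_le hB] at this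
          exact this
        · filter_upwards [ae_restrict_mem measurableSet_Ioc] with t ht
          have := ht.1
          simp only [Pi.zero_apply]
          positivity
    _ = _ := by
        rw [← intervalIntegral.integral_of_le hB, intervalIntegral.integral_const_mul,
          integral_rpow (Or.inl (by linarith))]
        rw [sub_add_cancel, Real.zero_rpow hs.ne', sub_zero]
        congr 1
        ring

lemma seq_mono {ρ : ℝ} (hρ : 1 < ρ) {t : ℤ → ℝ} (ht : ∀ n, 0 ≤ t n)
    (hr : ∀ n, ρ * t n ≤ t (n + 1)) : Monotone t :=
  monotone_int_of_le_succ fun n => le_trans (by nlinarith [ht n]) (hr n)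

lemma seq_grow {ρ : ℝ} (hρ : 1 < ρ) {t : ℤ → ℝ} (hr : ∀ n, ρ * t n ≤ t (n + 1)) (n : ℤ) (k : ℕ) :
    ρ ^ k * t n ≤ t (n + k) := by
  induction k with
  | zero => simp
  | succ k ih =>
    have := hr (n + k)
    rw [pow_succ']
    push_cast
    rw [← add_assoc]
    nlinarith

lemma disc_lower {θ Q ρ c : ℝ} (hθ : 0 < θ) (hθ1 : θ < 1) (hQ : 0 < Q) (hρ : 1 < ρ) (hc : 0 < c) :
    ∃ C : ℝ≥0∞, C ≠ ∞ ∧ ∀ (K : ℝ → ℝ≥0∞) (t m : ℤ → ℝ), (∀ n, 0 ≤ t n) → (∀ n, 0 < m n) →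
      (∀ n, ρ * t n ≤ t (n + 1)) →
      (∀ n s, t n ≤ s → ENNReal.ofReal (c * (t n * m n)) ≤ K s) →
      ∑' n, ENNReal.ofReal (t n ^ ((1 - θ) * Q) * m n ^ Q)
        ≤ C * ∫⁻ s in Ioi (0 : ℝ), itg K θ Q s := by
  have hρ0 : 0 < ρ := by linarith
  have hρi : 0 < 1 - ρ⁻¹ := by
    have : ρ⁻¹ < 1 := inv_lt_one_of_one_lt₀ hρ
    linarith
  set E : ℝ := ρ ^ (-(θ * Q)) * c ^ Q * (1 - ρ⁻¹) with hE
  have hE0 : 0 < E := by positivity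
  refine ⟨ENNReal.ofReal E⁻¹, ENNReal.ofReal_ne_top, ?_⟩
  intro K t m ht hm hr hK
  have hs : 0 < (1 - θ) * Q := mul_pos (by linarith) hQ
  have hmono := seq_mono hρ ht hr
  have hdisj : Pairwise (Function.onFun Disjoint fun n => Ioc (t n) (ρ * t n)) := by
    have key : ∀ n k, n < k → Disjoint (Ioc (t n) (ρ * t n)) (Ioc (t k) (ρ * t k)) := by
      intro n k hnk
      rw [Set.disjoint_left]
      intro x hx hx'
      have : t (n + 1) ≤ t k := hmono (by omega)
      linarith [hx.2, hx'.1, hr n]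
    intro n k hnk
    rcases lt_or_gt_of_ne hnk with h | h
    · exact key n k h
    · exact (key k n h).symm
  have hterm : ∀ n, ENNReal.ofReal (t n ^ ((1 - θ) * Q) * m n ^ Q)
      ≤ ENNReal.ofReal E⁻¹ * ∫⁻ s in Ioc (t n) (ρ * t n), itg K θ Q s := by
    intro n
    rcases (ht n).eq_or_lt with h | h
    · rw [← h, Real.zero_rpow hs.ne']; simp
    · have hmn := hm n
      have := itg_lower K (M := c * (t n * m n)) hθ hQ hρ h (by positivity)
        (fun s hs => hK n s hs)
      refine le_trans ?_ (mul_le_mul_right this _)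
      rw [← ENNReal.ofReal_mul (by positivity)]
      apply ENNReal.ofReal_le_ofReal
      apply le_of_eq
      have e : (ρ * t n) ^ (-(θ * Q)) * (c * (t n * m n)) ^ Q * (1 - ρ⁻¹)
          = E * (t n ^ ((1 - θ) * Q) * m n ^ Q) := by
        rw [Real.mul_rpow hρ0.le h.le, Real.mul_rpow hc.le (by positivity),
          Real.mul_rpow h.le hmn.le, show (1 - θ) * Q = -(θ * Q) + Q by ring, Real.rpow_add h, hE]
        ring
      rw [e, inv_mul_cancel_left₀ hE0.ne']
  calc _ ≤ ∑' n, ENNReal.ofReal E⁻¹ * ∫⁻ s in Ioc (t n) (ρ * t n), itg K θ Q s :=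
        ENNReal.tsum_le_tsum hterm
    _ = ENNReal.ofReal E⁻¹ * ∫⁻ s in ⋃ n, Ioc (t n) (ρ * t n), itg K θ Q s := by
        rw [ENNReal.tsum_mul_left, lintegral_iUnion (fun _ => measurableSet_Ioc) hdisj]
    _ ≤ _ := by
        gcongr
        refine Set.iUnion_subset fun n x hx => ?_
        exact lt_of_le_of_lt (ht n) hx.1

lemma disc_upper {θ Q ρ D : ℝ} (hθ1 : θ < 1) (hQ : 0 < Q) (hρ : 1 < ρ) (hD : 0 < D) :
    ∃ C : ℝ≥0∞, C ≠ ∞ ∧ ∀ (K : ℝ → ℝ≥0∞) (t m : ℤ → ℝ), (∀ n, 0 ≤ t n) → (∀ n, 0 < m n) →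
      (∀ n, ρ * t n ≤ t (n + 1)) → (∃ n, 0 < t n) → (∀ n, m n ≤ D * m (n + 1)) →
      (∀ n s, t n < s → K s ≤ ENNReal.ofReal (2 * m n * s)) →
      ∫⁻ s in Ioi (0 : ℝ), itg K θ Q s
        ≤ C * ∑' n, ENNReal.ofReal (t n ^ ((1 - θ) * Q) * m n ^ Q) := by
  have hs : 0 < (1 - θ) * Q := mul_pos (by linarith) hQ
  refine ⟨ENNReal.ofReal ((2 * D) ^ Q * ((1 - θ) * Q)⁻¹), ENNReal.ofReal_ne_top, ?_⟩
  intro K t m ht hm hr hex hmD hK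
  have hmono := seq_mono hρ ht hr
  have hcov : Ioi (0 : ℝ) ⊆ ⋃ n, Ioc (t n) (t (n + 1)) := by
    intro x hx
    have hx0 : 0 < x := hx
    obtain ⟨n0, hn0⟩ := hex
    obtain ⟨k1, hk1⟩ := pow_unbounded_of_one_lt (x / t n0) hρ
    have hup : x < t (n0 + k1) := by
      have := seq_grow hρ hr n0 k1
      rw [div_lt_iff₀ hn0] at hk1
      linarith
    obtain ⟨k2, hk2⟩ := pow_unbounded_of_one_lt (t n0 / x) hρ
    have hlo : t (n0 - k2) < x := by
      have := seq_grow hρ hr (n0 - k2) k2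
      rw [sub_add_cancel] at this
      rw [div_lt_iff₀ hx0] at hk2
      have h3 : ρ ^ k2 * t (n0 - k2) < ρ ^ k2 * x := by linarith
      exact lt_of_mul_lt_mul_left h3 (by positivity)
    obtain ⟨n, hn, hn'⟩ := Int.exists_greatest_of_bdd (P := fun n => t n < x)
      ⟨n0 + k1, fun z hz => by
        by_contra hcon
        have := hmono (not_le.1 hcon).le
        linarith⟩ ⟨n0 - k2, hlo⟩
    refine mem_iUnion.2 ⟨n, hn, ?_⟩
    by_contra hcon
    have := hn' (n + 1) (not_le.1 hcon)
    omega
  have hterm : ∀ n, ∫⁻ s in Ioc (t n) (t (n + 1)), itg K θ Q s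
      ≤ ENNReal.ofReal ((2 * D) ^ Q * ((1 - θ) * Q)⁻¹) *
        ENNReal.ofReal (t (n + 1) ^ ((1 - θ) * Q) * m (n + 1) ^ Q) := by
    intro n
    have hm1 := hm (n + 1)
    refine (itg_upper K (D := 2 * D * m (n + 1)) hθ1 hQ (ht n) (ht _) (by positivity)
      fun s hs1 hs2 => ?_).trans ?_
    · refine (hK n s hs1).trans (ENNReal.ofReal_le_ofReal ?_)
      have : 0 ≤ s := (ht n).trans hs1.le
      have := hmD n
      nlinarith
    · rw [← ENNReal.ofReal_mul (by positivity)]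
      apply ENNReal.ofReal_le_ofReal
      rw [Real.mul_rpow (by positivity) hm1.le]
      apply le_of_eq; ring
  calc _ ≤ ∫⁻ s in ⋃ n, Ioc (t n) (t (n + 1)), itg K θ Q s := lintegral_mono_set hcov
    _ ≤ ∑' n, ∫⁻ s in Ioc (t n) (t (n + 1)), itg K θ Q s := lintegral_iUnion_le _ _
    _ ≤ _ := ENNReal.tsum_le_tsum hterm
    _ = _ := by
        rw [ENNReal.tsum_mul_left]
        congr 1
        exact (Equiv.addRight (1 : ℤ)).tsum_eq
          (fun n => ENNReal.ofReal (t n ^ ((1 - θ) * Q) * m n ^ Q))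


/-! ### Part D: kernel sums -/

lemma geom_tsum_ne_top {E δ : ℝ} (hδ : 0 < δ) :
    ∑' j : ℤ, ENNReal.ofReal (E * (2 : ℝ) ^ (-δ * |(j : ℝ)|)) ≠ ∞ := by
  have h2 : (2 : ℝ) ^ (-δ) < 1 := Real.rpow_lt_one_of_one_lt_of_neg (by norm_num) (by linarith)
  have hs : Summable fun n : ℕ => ((2 : ℝ) ^ (-δ)) ^ n :=
    summable_geometric_of_lt_one (by positivity) h2
  have h : Summable fun j : ℤ => (2 : ℝ) ^ (-δ * |(j : ℝ)|) := by
    apply Summable.of_nat_of_neg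
    · refine hs.congr fun n => ?_
      rw [← Real.rpow_natCast, ← Real.rpow_mul (by norm_num)]; simp
    · refine hs.congr fun n => ?_
      rw [← Real.rpow_natCast, ← Real.rpow_mul (by norm_num)]; simp
  exact (h.mul_left E).tsum_ofReal_ne_top

lemma kernel_tsum_le {C : ℝ} (hC : 0 ≤ C) (k : ℤ) (g : ℤ → ℝ) (a : ℤ → ℝ)
    (h : ∀ n, a n ≤ C * g (n - k)) :
    ∑' n, ENNReal.ofReal (a n) ≤ ENNReal.ofReal C * ∑' j, ENNReal.ofReal (g j) := by
  calc _ ≤ ∑' n, ENNReal.ofReal C * ENNReal.ofReal (g (n - k)) := by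
        refine ENNReal.tsum_le_tsum fun n => ?_
        rw [← ENNReal.ofReal_mul hC]
        exact ENNReal.ofReal_le_ofReal (h n)
    _ = _ := by
        rw [ENNReal.tsum_mul_left]
        congr 1
        exact (Equiv.subRight k).tsum_eq (fun j => ENNReal.ofReal (g j))

/-- The kernel `min (b^{p₀}, 2^n b^{p₁})`. -/
lemma kernel_fin {p₀ p₁ η Q : ℝ} (hp₀ : 0 < p₀) (hp₁ : 0 < p₁) (hη : 0 < η) (hη1 : η < 1)
    (hQ : Q = (1 - η) * p₀ + η * p₁) :
    ∃ C : ℝ≥0∞, C ≠ ∞ ∧ ∀ b : ℝ≥0∞, b ≠ ∞ →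
      b ^ Q ≤ 2 * ∑' n : ℤ, ENNReal.ofReal ((2 : ℝ) ^ (-(n : ℝ) * η)) *
        min (b ^ p₀) (ENNReal.ofReal ((2 : ℝ) ^ (n : ℝ)) * b ^ p₁) ∧
      ∑' n : ℤ, ENNReal.ofReal ((2 : ℝ) ^ (-(n : ℝ) * η)) *
        min (b ^ p₀) (ENNReal.ofReal ((2 : ℝ) ^ (n : ℝ)) * b ^ p₁) ≤ C * b ^ Q := by
  have hQ0 : 0 < Q := by rw [hQ]; have : 0 < 1 - η := by linarith
                         positivity
  set δ := min η (1 - η) with hδ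
  have hδ0 : 0 < δ := lt_min hη (by linarith)
  refine ⟨_, geom_tsum_ne_top (E := 2 ^ η) hδ0, ?_⟩
  intro b hb
  rcases eq_or_ne b 0 with rfl | hb0
  · simp [ENNReal.zero_rpow_of_pos, hp₀, hp₁, hQ0]
  obtain ⟨β, hβ, rfl⟩ : ∃ β : ℝ, 0 < β ∧ b = ENNReal.ofReal β :=
    ⟨b.toReal, ENNReal.toReal_pos hb0 hb, (ENNReal.ofReal_toReal hb).symm⟩
  set y := Real.logb 2 (β ^ (p₀ - p₁)) with hy
  have h2y : (2 : ℝ) ^ y = β ^ (p₀ - p₁) :=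
    Real.rpow_logb (by norm_num) (by norm_num) (by positivity)
  set k := ⌊y⌋ with hk
  have hk1 : (k : ℝ) ≤ y := Int.floor_le y
  have hk2 : y < k + 1 := Int.lt_floor_add_one y
  have hβQ : β ^ Q = β ^ p₀ * (2 : ℝ) ^ (-(y * η)) := by
    rw [Real.rpow_neg (by norm_num), Real.rpow_mul (by norm_num), h2y, ← Real.rpow_mul hβ.le,
      ← Real.rpow_neg hβ.le, ← Real.rpow_add hβ, hQ]
    congr 1; ring
  have hβ1 : β ^ p₁ = β ^ p₀ * (2 : ℝ) ^ (-y) := by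
    rw [Real.rpow_neg (by norm_num), h2y, ← Real.rpow_neg hβ.le, ← Real.rpow_add hβ]
    congr 1; ring
  have hterm : ∀ n : ℤ, ENNReal.ofReal ((2 : ℝ) ^ (-(n : ℝ) * η)) *
        min (ENNReal.ofReal β ^ p₀) (ENNReal.ofReal ((2 : ℝ) ^ (n : ℝ)) * ENNReal.ofReal β ^ p₁)
      = ENNReal.ofReal (β ^ Q * ((2 : ℝ) ^ (-((n - y) * η)) * min 1 ((2 : ℝ) ^ (n - y)))) := by
    intro n
    rw [ENNReal.ofReal_rpow_of_pos hβ, ENNReal.ofReal_rpow_of_pos hβ,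
      ← ENNReal.ofReal_mul (by positivity), ← ENNReal.ofReal_min,
      ← ENNReal.ofReal_mul (by positivity)]
    congr 1
    rw [hβQ, hβ1]
    have e1 : min (β ^ p₀) ((2 : ℝ) ^ (n : ℝ) * (β ^ p₀ * (2 : ℝ) ^ (-y)))
        = β ^ p₀ * min 1 ((2 : ℝ) ^ (n - y)) := by
      rw [mul_min_of_nonneg _ _ (by positivity), mul_one, sub_eq_add_neg,
        Real.rpow_add (by norm_num)]
      congr 1; ring
    have e2 : (2 : ℝ) ^ (-(n : ℝ) * η) = (2 : ℝ) ^ (-(y * η)) * (2 : ℝ) ^ (-((n - y) * η)) := by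
      rw [← Real.rpow_add (by norm_num)]; congr 1; ring
    rw [e1, e2]; ring
  simp_rw [hterm]
  rw [ENNReal.ofReal_rpow_of_pos hβ]
  constructor
  · refine le_trans ?_ (mul_le_mul_right (ENNReal.le_tsum k) _)
    rw [show (2 : ℝ≥0∞) = ENNReal.ofReal 2 by simp, ← ENNReal.ofReal_mul (by norm_num)]
    apply ENNReal.ofReal_le_ofReal
    have e1 : (1 : ℝ) ≤ (2 : ℝ) ^ (-((k - y) * η)) :=
      Real.one_le_rpow (by norm_num) (by nlinarith)
    have e2 : (1 / 2 : ℝ) ≤ min 1 ((2 : ℝ) ^ (k - y)) := by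
      refine le_min (by norm_num) ?_
      calc (1 / 2 : ℝ) = (2 : ℝ) ^ (-1 : ℝ) := by rw [Real.rpow_neg_one]; norm_num
        _ ≤ _ := Real.rpow_le_rpow_of_exponent_le (by norm_num) (by linarith)
    have e3 : 0 < β ^ Q := by positivity
    have e4 : (1 / 2 : ℝ) ≤ (2 : ℝ) ^ (-((k - y) * η)) * min 1 ((2 : ℝ) ^ (k - y)) := by nlinarith
    nlinarith
  · rw [mul_comm]
    refine kernel_tsum_le (by positivity) k _ _ fun n => ?_
    refine mul_le_mul_of_nonneg_left ?_ (by positivity)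
    have hd1 : δ ≤ η := min_le_left _ _
    have hd2 : δ ≤ 1 - η := min_le_right _ _
    rcases le_or_gt k n with h | h
    · have h' : (k : ℝ) ≤ n := by exact_mod_cast h
      have : |((n - k : ℤ) : ℝ)| = n - k := by
        push_cast; exact abs_of_nonneg (by linarith)
      rw [this]
      calc (2 : ℝ) ^ (-((n - y) * η)) * min 1 ((2 : ℝ) ^ (n - y))
          ≤ (2 : ℝ) ^ (-((n - y) * η)) * 1 := by gcongr; exact min_le_left _ _
        _ ≤ (2 : ℝ) ^ (η + -δ * (n - k)) := by
            rw [mul_one]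
            apply Real.rpow_le_rpow_of_exponent_le (by norm_num)
            nlinarith
        _ = _ := Real.rpow_add (by norm_num) _ _
    · have h' : (n : ℝ) ≤ k := by exact_mod_cast h.le
      have : |((n - k : ℤ) : ℝ)| = k - n := by
        push_cast; rw [abs_of_nonpos (by linarith)]; ring
      rw [this]
      calc (2 : ℝ) ^ (-((n - y) * η)) * min 1 ((2 : ℝ) ^ (n - y))
          ≤ (2 : ℝ) ^ (-((n - y) * η)) * (2 : ℝ) ^ (n - y) := by gcongr; exact min_le_right _ _
        _ = (2 : ℝ) ^ ((n - y) * (1 - η)) := by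
            rw [← Real.rpow_add (by norm_num)]; congr 1; ring
        _ ≤ (2 : ℝ) ^ (η + -δ * (k - n)) := by
            apply Real.rpow_le_rpow_of_exponent_le (by norm_num)
            nlinarith
        _ = _ := Real.rpow_add (by norm_num) _ _

/-- The kernel `b^{p₀} [b > 2^{-n}]`. -/
lemma kernel_inf {p₀ σ Q : ℝ} (hp₀ : 0 < p₀) (hσ : 0 < σ) (hQ : Q = p₀ + σ) :
    ∃ C : ℝ≥0∞, C ≠ ∞ ∧ ∀ b : ℝ≥0∞, b ≠ ∞ →
      b ^ Q ≤ ENNReal.ofReal (2 ^ σ) * ∑' n : ℤ, ENNReal.ofReal ((2 : ℝ) ^ (-(n : ℝ) * σ)) *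
        (if ENNReal.ofReal ((2 : ℝ) ^ (-(n : ℝ))) < b then b ^ p₀ else 0) ∧
      ∑' n : ℤ, ENNReal.ofReal ((2 : ℝ) ^ (-(n : ℝ) * σ)) *
        (if ENNReal.ofReal ((2 : ℝ) ^ (-(n : ℝ))) < b then b ^ p₀ else 0) ≤ C * b ^ Q := by
  have hQ0 : 0 < Q := by rw [hQ]; positivity
  refine ⟨_, geom_tsum_ne_top (E := 2 ^ σ) hσ, ?_⟩
  intro b hb
  rcases eq_or_ne b 0 with rfl | hb0
  · simp [ENNReal.zero_rpow_of_pos, hQ0]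
  obtain ⟨β, hβ, rfl⟩ : ∃ β : ℝ, 0 < β ∧ b = ENNReal.ofReal β :=
    ⟨b.toReal, ENNReal.toReal_pos hb0 hb, (ENNReal.ofReal_toReal hb).symm⟩
  set y := -Real.logb 2 β with hy
  have h2y : (2 : ℝ) ^ (-y) = β := by
    rw [hy, neg_neg]; exact Real.rpow_logb (by norm_num) (by norm_num) hβ
  set k := ⌊y⌋ with hk
  have hk1 : (k : ℝ) ≤ y := Int.floor_le y
  have hk2 : y < k + 1 := Int.lt_floor_add_one y
  have hβQ : β ^ Q = β ^ p₀ * (2 : ℝ) ^ (-(y * σ)) := by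
    rw [← neg_mul, Real.rpow_mul (by norm_num), h2y, ← Real.rpow_add hβ, hQ]
  have hcond : ∀ n : ℤ, ENNReal.ofReal ((2 : ℝ) ^ (-(n : ℝ))) < ENNReal.ofReal β ↔ y < n := by
    intro n
    rw [ENNReal.ofReal_lt_ofReal_iff hβ]
    nth_rewrite 1 [← h2y]
    rw [Real.rpow_lt_rpow_left_iff (by norm_num)]
    constructor <;> intro h <;> linarith
  have hterm : ∀ n : ℤ, ENNReal.ofReal ((2 : ℝ) ^ (-(n : ℝ) * σ)) *
        (if ENNReal.ofReal ((2 : ℝ) ^ (-(n : ℝ))) < ENNReal.ofReal β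
          then ENNReal.ofReal β ^ p₀ else 0)
      = ENNReal.ofReal (β ^ Q * (if y < n then (2 : ℝ) ^ (-((n - y) * σ)) else 0)) := by
    intro n
    simp only [hcond]
    split_ifs
    · rw [ENNReal.ofReal_rpow_of_pos hβ, ← ENNReal.ofReal_mul (by positivity)]
      congr 1
      rw [hβQ]
      have e2 : (2 : ℝ) ^ (-(n : ℝ) * σ) = (2 : ℝ) ^ (-(y * σ)) * (2 : ℝ) ^ (-((n - y) * σ)) := by
        rw [← Real.rpow_add (by norm_num)]; congr 1; ring
      rw [e2]; ring
    · simp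
  simp_rw [hterm]
  rw [ENNReal.ofReal_rpow_of_pos hβ]
  constructor
  · refine le_trans ?_ (mul_le_mul_right (ENNReal.le_tsum (k + 1)) _)
    rw [← ENNReal.ofReal_mul (by positivity)]
    apply ENNReal.ofReal_le_ofReal
    push_cast
    rw [if_pos hk2, mul_left_comm, ← Real.rpow_add (by norm_num)]
    have e1 : (1 : ℝ) ≤ (2 : ℝ) ^ (σ + -(((k : ℝ) + 1 - y) * σ)) :=
      Real.one_le_rpow (by norm_num) (by nlinarith)
    have e3 : 0 < β ^ Q := by positivity
    nlinarith
  · rw [mul_comm]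
    refine kernel_tsum_le (by positivity) k _ _ fun n => ?_
    gcongr
    split_ifs with h
    · have h0 : k < n := by exact_mod_cast hk1.trans_lt h
      have h' : (k : ℝ) ≤ n := by exact_mod_cast h0.le
      have : |((n - k : ℤ) : ℝ)| = n - k := by
        push_cast; exact abs_of_nonneg (by linarith)
      rw [this, ← Real.rpow_add (by norm_num)]
      apply Real.rpow_le_rpow_of_exponent_le (by norm_num)
      nlinarith
    · positivity


/-! ### Part E: the scalar theorem -/

lemma exps {θ : ℝ} (hθ0 : 0 < θ) (hθ1 : θ < 1) {p₀ p₁ Q : ℝ} (hp₀ : 0 < p₀) (hp₁ : 0 < p₁)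
    (hQ : 0 < Q) (h : Q⁻¹ = (1 - θ) * p₀⁻¹ + θ * p₁⁻¹) :
    0 < θ * Q / p₁ ∧ θ * Q / p₁ < 1 ∧ (1 - θ) * Q / p₀ = 1 - θ * Q / p₁ := by
  have h1 : (1 - θ) * Q / p₀ = 1 - θ * Q / p₁ := by
    have h2 : Q * Q⁻¹ = Q * ((1 - θ) * p₀⁻¹ + θ * p₁⁻¹) := by rw [h]
    rw [mul_inv_cancel₀ hQ.ne'] at h2
    rw [div_eq_mul_inv, div_eq_mul_inv]
    linarith
  have h3 : 0 < (1 - θ) * Q / p₀ := by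
    have : 0 < 1 - θ := by linarith
    positivity
  exact ⟨by positivity, by linarith, h1⟩

lemma scalar_fin_int {ι : Type*} {θ : ℝ} (hθ0 : 0 < θ) (hθ1 : θ < 1) {p₀ p₁ Q : ℝ}
    (hp₀ : 0 < p₀) (hp₁ : 0 < p₁) (hQ : 0 < Q) (h : Q⁻¹ = (1 - θ) * p₀⁻¹ + θ * p₁⁻¹)
    (K : (ι → ℝ≥0∞) → ℝ → ℝ≥0∞)
    (hKdef : ∀ b t, K b t = ⨅ S : Set ι, (∑' u, S.indicator b u ^ p₀) ^ p₀⁻¹ +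
      ENNReal.ofReal t * (∑' u, Sᶜ.indicator b u ^ p₁) ^ p₁⁻¹) :
    ∃ C₁ C₂ : ℝ≥0∞, C₁ ≠ ∞ ∧ C₂ ≠ ∞ ∧ ∀ b : ι → ℝ≥0∞, (∀ u, b u ≠ ∞) → (∃ u, b u ≠ 0) →
      K b 1 ≠ ∞ →
      ∑' u, b u ^ Q ≤ C₁ * ∫⁻ s in Ioi (0 : ℝ), itg (K b) θ Q s ∧
      ∫⁻ s in Ioi (0 : ℝ), itg (K b) θ Q s ≤ C₂ * ∑' u, b u ^ Q := by
  obtain ⟨hη0, hη1, hη⟩ := exps hθ0 hθ1 hp₀ hp₁ hQ h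
  set η := θ * Q / p₁ with hηdef
  have hQη : Q = (1 - η) * p₀ + η * p₁ := by
    rw [← hη, hηdef]; field_simp; ring
  obtain ⟨Ck, hCk, hker⟩ := kernel_fin hp₀ hp₁ hη0 hη1 hQη
  set δ := min p₀⁻¹ p₁⁻¹ with hδ
  have hδ0 : 0 < δ := lt_min (by positivity) (by positivity)
  have hρ : 1 < (2 : ℝ) ^ δ := Real.one_lt_rpow (by norm_num) hδ0
  set c : ℝ := min ((1 / 2) ^ p₀⁻¹) ((1 / 2) ^ p₁⁻¹) with hc
  have hc0 : 0 < c := lt_min (by positivity) (by positivity)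
  obtain ⟨Cl, hCl, hlow⟩ := disc_lower hθ0 hθ1 hQ hρ hc0
  obtain ⟨Cu, hCu, hupp⟩ := disc_upper (D := 2 ^ p₁⁻¹) hθ1 hQ hρ (by positivity)
  refine ⟨2 * Cl, Cu * Ck, ENNReal.mul_ne_top (by simp) hCl, ENNReal.mul_ne_top hCu hCk, ?_⟩
  intro b hb hbne hK1
  set w : ℤ → ℝ := fun n => (2 : ℝ) ^ (n : ℝ) with hw
  have hw0 : ∀ n, 0 < w n := fun n => by simp only [hw]; positivity
  have hwE : ∀ n, ENNReal.ofReal (w n) ≠ 0 := fun n => by simpa using hw0 n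
  have hw1 : ∀ n, w (n + 1) = 2 * w n := fun n => by
    simp only [hw]; push_cast; rw [Real.rpow_add (by norm_num), Real.rpow_one]; ring
  set F : ℤ → ℝ≥0∞ := fun n => ∑' u, min (b u ^ p₀) (ENNReal.ofReal (w n) * b u ^ p₁) with hF
  have hFle : ∀ n (S : Set ι), F n ≤ (∑' u, S.indicator b u ^ p₀) +
      ENNReal.ofReal (w n) * ∑' u, Sᶜ.indicator b u ^ p₁ := by
    intro n S
    rw [← ENNReal.tsum_mul_left, ← ENNReal.tsum_add]
    refine ENNReal.tsum_le_tsum fun u => ?_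
    by_cases hu : u ∈ S
    · rw [Set.indicator_of_mem hu]
      exact (min_le_left _ _).trans le_self_add
    · rw [Set.indicator_of_mem (s := Sᶜ) hu]
      exact (min_le_right _ _).trans le_add_self
  have hFfin : ∀ n, F n ≠ ∞ := by
    intro n
    rw [hKdef] at hK1
    have : ∃ S : Set ι, (∑' u, S.indicator b u ^ p₀) ^ p₀⁻¹ +
      ENNReal.ofReal 1 * (∑' u, Sᶜ.indicator b u ^ p₁) ^ p₁⁻¹ ≠ ∞ := by
      by_contra hcon
      push Not at hcon
      exact hK1 (by simp only [hcon, iInf_const])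
    obtain ⟨S, hS⟩ := this
    rw [ENNReal.add_ne_top, ENNReal.ofReal_one, one_mul] at hS
    refine ne_top_of_le_ne_top ?_ (hFle n S)
    refine ENNReal.add_ne_top.2 ⟨?_, ENNReal.mul_ne_top ENNReal.ofReal_ne_top ?_⟩
    · intro hh
      apply hS.1
      rw [hh, ENNReal.top_rpow_of_pos (by positivity)]
    · intro hh
      apply hS.2
      rw [hh, ENNReal.top_rpow_of_pos (by positivity)]
  have hFpos : ∀ n, F n ≠ 0 := by
    intro n hn
    obtain ⟨u, hu⟩ := hbne
    have h1 := ENNReal.tsum_eq_zero.1 hn u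
    have h2 : b u ^ p₀ ≠ 0 := (ENNReal.rpow_pos (pos_iff_ne_zero.2 hu) (hb u)).ne'
    have h3 : b u ^ p₁ ≠ 0 := (ENNReal.rpow_pos (pos_iff_ne_zero.2 hu) (hb u)).ne'
    rcases min_choice (b u ^ p₀) (ENNReal.ofReal (w n) * b u ^ p₁) with h | h
    · rw [h] at h1; exact h2 h1
    · rw [h] at h1; exact mul_ne_zero (hwE n) h3 h1
  set Φ : ℤ → ℝ := fun n => (F n).toReal with hΦ
  have hΦ0 : ∀ n, 0 < Φ n := fun n => ENNReal.toReal_pos (hFpos n) (hFfin n)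
  have hFΦ : ∀ n, F n = ENNReal.ofReal (Φ n) := fun n => (ENNReal.ofReal_toReal (hFfin n)).symm
  have hΦ1 : ∀ n, Φ n ≤ Φ (n + 1) := by
    intro n
    refine ENNReal.toReal_mono (hFfin _) (ENNReal.tsum_le_tsum fun u => ?_)
    gcongr
    rw [hw1]; linarith [hw0 n]
  have hΦ2 : ∀ n, Φ (n + 1) ≤ 2 * Φ n := by
    intro n
    have : F (n + 1) ≤ 2 * F n := by
      simp only [hF]
      rw [← ENNReal.tsum_mul_left]
      refine ENNReal.tsum_le_tsum fun u => ?_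
      rw [hw1, ENNReal.ofReal_mul (by norm_num), show ENNReal.ofReal 2 = 2 by simp, mul_assoc]
      rcases min_choice (b u ^ p₀) (ENNReal.ofReal (w n) * b u ^ p₁) with h | h
      · rw [h]
        refine (min_le_left _ _).trans ?_
        rw [two_mul]; exact le_self_add
      · rw [h]; exact min_le_right _ _
    have := ENNReal.toReal_mono (ENNReal.mul_ne_top (by simp) (hFfin n)) this
    simpa using this
  set m : ℤ → ℝ := fun n => (Φ n / w n) ^ p₁⁻¹ with hm
  have hm0 : ∀ n, 0 < m n := fun n => by
    have := hΦ0 n; have := hw0 n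
    simp only [hm]; positivity
  set t : ℤ → ℝ := fun n => Φ n ^ p₀⁻¹ / m n with ht
  have ht0 : ∀ n, 0 < t n := fun n => by
    have := hΦ0 n; have := hm0 n
    simp only [ht]; positivity
  have htm : ∀ n, t n * m n = Φ n ^ p₀⁻¹ := fun n => by
    simp only [ht]; exact div_mul_cancel₀ _ (hm0 n).ne'
  have htr : ∀ n, (2 : ℝ) ^ δ * t n ≤ t (n + 1) := by
    intro n
    have a0 := hΦ0 n
    have a1 := hΦ0 (n + 1)
    have a2 := hw0 n
    set x := Φ (n + 1) / Φ n with hx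
    have hx1 : 1 ≤ x := by rw [hx, one_le_div a0]; exact hΦ1 n
    have hx2 : 1 ≤ 2 / x := by
      rw [one_le_div (by linarith), hx, div_le_iff₀ a0]; exact hΦ2 n
    have e1 : Φ (n + 1) = x * Φ n := by rw [hx]; field_simp
    have e2 : Φ (n + 1) / w (n + 1) = (2 / x)⁻¹ * (Φ n / w n) := by
      rw [hw1, e1]; field_simp
    have e3 : t (n + 1) = x ^ p₀⁻¹ * (2 / x) ^ p₁⁻¹ * t n := by
      simp only [ht, hm]
      rw [e2, e1, Real.mul_rpow (by positivity) (by positivity),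
        Real.mul_rpow (by positivity) (by positivity), Real.inv_rpow (by positivity)]
      field_simp
    rw [e3]
    refine mul_le_mul_of_nonneg_right ?_ (ht0 n).le
    calc (2 : ℝ) ^ δ = x ^ δ * (2 / x) ^ δ := by
          rw [← Real.mul_rpow (by positivity) (by positivity)]
          congr 1; field_simp
      _ ≤ _ := by
          gcongr
          · exact min_le_left _ _
          · exact min_le_right _ _
  have hKlow : ∀ n s, t n ≤ s → ENNReal.ofReal (c * (t n * m n)) ≤ K b s := by
    intro n s hs
    have a0 := hΦ0 n
    have a2 := hw0 n
    have a3 := hm0 n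
    have a4 := ht0 n
    have hs0 : 0 < s := a4.trans_le hs
    rw [hKdef]
    refine le_iInf fun S => ?_
    have hle := hFle n S
    set A := ∑' u, S.indicator b u ^ p₀
    set B := ∑' u, Sᶜ.indicator b u ^ p₁
    by_cases hA : ENNReal.ofReal (Φ n / 2) ≤ A
    · refine le_trans ?_ le_self_add
      refine le_trans ?_ (ENNReal.rpow_le_rpow hA (by positivity))
      rw [ENNReal.ofReal_rpow_of_pos (by positivity)]
      apply ENNReal.ofReal_le_ofReal
      rw [htm, show Φ n / 2 = (1 / 2) * Φ n by ring,
        Real.mul_rpow (by positivity) (by positivity)]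
      gcongr
      exact min_le_left _ _
    · have hB : ENNReal.ofReal (Φ n / 2 / w n) ≤ B := by
        by_contra hcon
        rw [not_le] at hA hcon
        have : A + ENNReal.ofReal (w n) * B < ENNReal.ofReal (Φ n / 2) +
            ENNReal.ofReal (w n) * ENNReal.ofReal (Φ n / 2 / w n) := by
          apply ENNReal.add_lt_add hA
          exact (ENNReal.mul_lt_mul_iff_right (hwE n) ENNReal.ofReal_ne_top).2 hcon
        rw [← ENNReal.ofReal_mul (by positivity), ← ENNReal.ofReal_add (by positivity)
          (by positivity)] at this
        rw [show Φ n / 2 + w n * (Φ n / 2 / w n) = Φ n by field_simp; ring, ← hFΦ] at this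
        exact absurd hle (not_le.2 this)
      refine le_trans ?_ le_add_self
      refine le_trans ?_ (mul_le_mul_right (ENNReal.rpow_le_rpow hB (by positivity)) _)
      rw [ENNReal.ofReal_rpow_of_pos (by positivity), ← ENNReal.ofReal_mul hs0.le]
      apply ENNReal.ofReal_le_ofReal
      rw [show Φ n / 2 / w n = (1 / 2) * (Φ n / w n) by ring,
        Real.mul_rpow (by positivity) (by positivity)]
      change c * (t n * m n) ≤ s * ((1 / 2) ^ p₁⁻¹ * m n)
      have hcc : c ≤ (1 / 2) ^ p₁⁻¹ := min_le_right _ _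
      calc c * (t n * m n) ≤ (1 / 2) ^ p₁⁻¹ * (s * m n) := by gcongr
        _ = _ := by ring
  have hKup : ∀ n s, t n < s → K b s ≤ ENNReal.ofReal (2 * m n * s) := by
    intro n s hs
    have a0 := hΦ0 n
    have a2 := hw0 n
    have a3 := hm0 n
    have a4 := ht0 n
    have hs0 : 0 < s := a4.trans hs
    rw [hKdef]
    set S : Set ι := {u | b u ^ p₀ ≤ ENNReal.ofReal (w n) * b u ^ p₁} with hS
    refine (iInf_le _ S).trans ?_
    have hA : ∑' u, S.indicator b u ^ p₀ ≤ ENNReal.ofReal (Φ n) := by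
      rw [← hFΦ]
      refine ENNReal.tsum_le_tsum fun u => ?_
      by_cases hu : u ∈ S
      · rw [Set.indicator_of_mem hu]
        exact le_min le_rfl hu
      · rw [Set.indicator_of_notMem hu, ENNReal.zero_rpow_of_pos hp₀]; exact bot_le
    have hB : ∑' u, Sᶜ.indicator b u ^ p₁ ≤ ENNReal.ofReal (Φ n / w n) := by
      rw [ENNReal.ofReal_div_of_pos a2, ← hFΦ,
        ENNReal.le_div_iff_mul_le (Or.inl (hwE n)) (Or.inl ENNReal.ofReal_ne_top), mul_comm,
        ← ENNReal.tsum_mul_left]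
      refine ENNReal.tsum_le_tsum fun u => ?_
      by_cases hu : u ∈ S
      · rw [Set.indicator_of_notMem (by simpa using hu), ENNReal.zero_rpow_of_pos hp₁, mul_zero]
        exact bot_le
      · rw [Set.indicator_of_mem (s := Sᶜ) hu]
        exact le_min (not_le.1 hu).le le_rfl
    calc _ ≤ ENNReal.ofReal (Φ n) ^ p₀⁻¹ +
          ENNReal.ofReal s * ENNReal.ofReal (Φ n / w n) ^ p₁⁻¹ := by gcongr
      _ = ENNReal.ofReal (t n * m n + s * m n) := by
          rw [ENNReal.ofReal_rpow_of_pos a0, ENNReal.ofReal_rpow_of_pos (by positivity),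
            ← ENNReal.ofReal_mul hs0.le, ← ENNReal.ofReal_add (by positivity) (by positivity), htm]
      _ ≤ _ := by
          apply ENNReal.ofReal_le_ofReal
          nlinarith
  have hmD : ∀ n, m n ≤ 2 ^ p₁⁻¹ * m (n + 1) := by
    intro n
    have a0 := hΦ0 n
    have a1 := hΦ0 (n + 1)
    have a2 := hw0 n
    simp only [hm]
    rw [← Real.mul_rpow (by norm_num) (by rw [hw1]; positivity), hw1,
      show 2 * (Φ (n + 1) / (2 * w n)) = Φ (n + 1) / w n by field_simp]
    have := hΦ1 n
    gcongr
  have hsum : ∑' n, ENNReal.ofReal (t n ^ ((1 - θ) * Q) * m n ^ Q)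
      = ∑' u, ∑' n : ℤ, ENNReal.ofReal ((2 : ℝ) ^ (-(n : ℝ) * η)) *
        min (b u ^ p₀) (ENNReal.ofReal ((2 : ℝ) ^ (n : ℝ)) * b u ^ p₁) := by
    rw [ENNReal.tsum_comm]
    congr 1; ext n
    rw [ENNReal.tsum_mul_left]
    change _ = _ * F n
    rw [hFΦ, ← ENNReal.ofReal_mul (by positivity)]
    congr 1
    have a0 := hΦ0 n
    have a2 := hw0 n
    have a3 := hm0 n
    have e1 : t n ^ ((1 - θ) * Q) * m n ^ Q = (Φ n ^ p₀⁻¹) ^ ((1 - θ) * Q) * m n ^ (θ * Q) := by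
      simp only [ht]
      rw [Real.div_rpow (by positivity) a3.le, show Q = (1 - θ) * Q + θ * Q by ring,
        Real.rpow_add a3, ← show Q = (1 - θ) * Q + θ * Q by ring]
      field_simp
    rw [e1, ← Real.rpow_mul a0.le]
    simp only [hm]
    rw [← Real.rpow_mul (by positivity), show p₀⁻¹ * ((1 - θ) * Q) = 1 - η by
      rw [← hη]; ring, show p₁⁻¹ * (θ * Q) = η by rw [hηdef]; ring,
      Real.div_rpow a0.le a2.le, Real.rpow_sub a0, Real.rpow_one]
    simp only [hw]
    rw [← Real.rpow_mul (by norm_num), neg_mul, Real.rpow_neg (by norm_num)]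
    field_simp
  constructor
  · calc ∑' u, b u ^ Q ≤ ∑' u, 2 * ∑' n : ℤ, ENNReal.ofReal ((2 : ℝ) ^ (-(n : ℝ) * η)) *
        min (b u ^ p₀) (ENNReal.ofReal ((2 : ℝ) ^ (n : ℝ)) * b u ^ p₁) :=
          ENNReal.tsum_le_tsum fun u => (hker _ (hb u)).1
      _ = 2 * ∑' n, ENNReal.ofReal (t n ^ ((1 - θ) * Q) * m n ^ Q) := by
          rw [ENNReal.tsum_mul_left, hsum]
      _ ≤ 2 * (Cl * _) := by
          gcongr
          exact hlow (K b) t m (fun n => (ht0 n).le) hm0 htr hKlow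
      _ = _ := by rw [mul_assoc]
  · calc _ ≤ Cu * ∑' n, ENNReal.ofReal (t n ^ ((1 - θ) * Q) * m n ^ Q) :=
          hupp (K b) t m (fun n => (ht0 n).le) hm0 htr ⟨0, ht0 0⟩ hmD hKup
      _ ≤ Cu * (Ck * ∑' u, b u ^ Q) := by
          rw [hsum, ← ENNReal.tsum_mul_left (a := Ck)]
          exact mul_le_mul_right (ENNReal.tsum_le_tsum fun u => (hker _ (hb u)).2) _
      _ = _ := by rw [mul_assoc]


lemma itg_eq_top (K : ℝ → ℝ≥0∞) {θ Q m : ℝ} (hθ0 : 0 < θ) (hθ1 : θ < 1) (hQ : 0 < Q) (hm : 0 < m)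
    (hK : ∀ s, 0 < s → ENNReal.ofReal (s * m) ≤ K s) :
    ∫⁻ s in Ioi (0 : ℝ), itg K θ Q s = ∞ := by
  by_contra hJ
  set J := ∫⁻ s in Ioi (0 : ℝ), itg K θ Q s with hJdef
  set E : ℝ := 2 ^ (-(θ * Q)) * m ^ Q * (1 - 2⁻¹) with hE
  have hE0 : 0 < E := by
    have : (0 : ℝ) < 1 - 2⁻¹ := by norm_num
    positivity
  have hs : 0 < (1 - θ) * Q := mul_pos (by linarith) hQ
  have hR : 0 < (J.toReal + 1) / E := by positivity
  set A : ℝ := ((J.toReal + 1) / E) ^ ((1 - θ) * Q)⁻¹ with hA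
  have hA0 : 0 < A := by positivity
  have h1 := itg_lower K (ρ := 2) (M := A * m) hθ0 hQ (by norm_num) hA0 (by positivity)
    (fun s hs => le_trans (ENNReal.ofReal_le_ofReal (by gcongr)) (hK s (hA0.trans_le hs)))
  have h2 : ∫⁻ s in Ioc A (2 * A), itg K θ Q s ≤ J :=
    lintegral_mono_set fun x hx => hA0.trans hx.1
  have e : (2 * A) ^ (-(θ * Q)) * (A * m) ^ Q * (1 - 2⁻¹) = J.toReal + 1 := by
    rw [Real.mul_rpow (by norm_num) hA0.le, Real.mul_rpow hA0.le hm.le]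
    have e2 : A ^ (-(θ * Q)) * A ^ Q = (J.toReal + 1) / E := by
      rw [← Real.rpow_add hA0, show -(θ * Q) + Q = (1 - θ) * Q by ring, hA,
        ← Real.rpow_mul hR.le, inv_mul_cancel₀ hs.ne', Real.rpow_one]
    calc _ = E * (A ^ (-(θ * Q)) * A ^ Q) := by rw [hE]; ring
      _ = _ := by rw [e2]; field_simp
  rw [e] at h1
  have h3 := h1.trans h2
  have h3 := (ENNReal.ofReal_le_iff_le_toReal hJ).1 h3
  linarith

lemma scalar_inf_int {ι : Type*} {θ : ℝ} (hθ0 : 0 < θ) (hθ1 : θ < 1) {p₀ Q : ℝ}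
    (hp₀ : 0 < p₀) (hQ : 0 < Q) (h : Q⁻¹ = (1 - θ) * p₀⁻¹)
    (K : (ι → ℝ≥0∞) → ℝ → ℝ≥0∞)
    (hKdef : ∀ b t, K b t = ⨅ S : Set ι, (∑' u, S.indicator b u ^ p₀) ^ p₀⁻¹ +
      ENNReal.ofReal t * ⨆ u, Sᶜ.indicator b u) :
    ∃ C₁ C₂ : ℝ≥0∞, C₁ ≠ ∞ ∧ C₂ ≠ ∞ ∧ ∀ b : ι → ℝ≥0∞, (∀ u, b u ≠ ∞) → (∃ u, b u ≠ 0) →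
      ∑' u, b u ^ Q ≤ C₁ * ∫⁻ s in Ioi (0 : ℝ), itg (K b) θ Q s ∧
      ∫⁻ s in Ioi (0 : ℝ), itg (K b) θ Q s ≤ C₂ * ∑' u, b u ^ Q := by
  have hpQ : p₀ = (1 - θ) * Q := by
    field_simp at h
    linarith
  set σ := θ * Q with hσ
  have hσ0 : 0 < σ := by positivity
  obtain ⟨Ck, hCk, hker⟩ := kernel_inf hp₀ hσ0 (show Q = p₀ + σ by rw [hpQ, hσ]; ring)
  obtain ⟨Cl, hCl, hlow⟩ := disc_lower (ρ := 2) (c := 1) hθ0 hθ1 hQ (by norm_num) (by norm_num)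
  obtain ⟨Cu, hCu, hupp⟩ := disc_upper (ρ := 2) (D := 2) hθ1 hQ (by norm_num) (by norm_num)
  refine ⟨ENNReal.ofReal (2 ^ σ) * Cl + 1, Cu * Ck + 1,
    ENNReal.add_ne_top.2 ⟨ENNReal.mul_ne_top ENNReal.ofReal_ne_top hCl, by simp⟩,
    ENNReal.add_ne_top.2 ⟨ENNReal.mul_ne_top hCu hCk, by simp⟩, ?_⟩
  intro b hb hbne
  set m : ℤ → ℝ := fun n => (2 : ℝ) ^ (-(n : ℝ)) with hm
  have hm0 : ∀ n, 0 < m n := fun n => by simp only [hm]; positivity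
  have hm1 : ∀ n, m n = 2 * m (n + 1) := fun n => by
    simp only [hm]; push_cast
    rw [neg_add, Real.rpow_add (by norm_num), Real.rpow_neg_one]; ring
  set F : ℤ → ℝ≥0∞ := fun n => ∑' u, if ENNReal.ofReal (m n) < b u then b u ^ p₀ else 0 with hF
  have hFle : ∀ n (S : Set ι), F n ≤ (∑' u, S.indicator b u ^ p₀) ∨
      ENNReal.ofReal (m n) ≤ ⨆ u, Sᶜ.indicator b u := by
    intro n S
    by_contra hcon
    push Not at hcon
    refine absurd hcon.1 (not_lt.2 (ENNReal.tsum_le_tsum fun u => ?_))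
    split_ifs with hu
    · by_cases huS : u ∈ S
      · rw [Set.indicator_of_mem huS]
      · exfalso
        have := le_iSup (fun u => Sᶜ.indicator b u) u
        rw [Set.indicator_of_mem (s := Sᶜ) huS] at this
        exact absurd (hu.trans_le this) (not_lt.2 hcon.2.le)
    · exact bot_le
  have hsumF : ∑' n : ℤ, ENNReal.ofReal ((2 : ℝ) ^ (-(n : ℝ) * σ)) * F n
      = ∑' u, ∑' n : ℤ, ENNReal.ofReal ((2 : ℝ) ^ (-(n : ℝ) * σ)) *
        (if ENNReal.ofReal ((2 : ℝ) ^ (-(n : ℝ))) < b u then b u ^ p₀ else 0) := by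
    rw [ENNReal.tsum_comm]
    congr 1; ext n
    rw [ENNReal.tsum_mul_left]
  have hlow1 : ∑' u, b u ^ Q ≤ ENNReal.ofReal (2 ^ σ) *
      ∑' n : ℤ, ENNReal.ofReal ((2 : ℝ) ^ (-(n : ℝ) * σ)) * F n := by
    rw [hsumF, ← ENNReal.tsum_mul_left]
    exact ENNReal.tsum_le_tsum fun u => (hker _ (hb u)).1
  have hup1 : ∑' n : ℤ, ENNReal.ofReal ((2 : ℝ) ^ (-(n : ℝ) * σ)) * F n
      ≤ Ck * ∑' u, b u ^ Q := by
    rw [hsumF, ← ENNReal.tsum_mul_left]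
    exact ENNReal.tsum_le_tsum fun u => (hker _ (hb u)).2
  by_cases hFfin : ∀ n, F n ≠ ∞
  swap
  · push Not at hFfin
    obtain ⟨n, hn⟩ := hFfin
    have hJ : ∫⁻ s in Ioi (0 : ℝ), itg (K b) θ Q s = ∞ := by
      refine itg_eq_top (K b) hθ0 hθ1 hQ (hm0 n) fun s hs => ?_
      rw [hKdef]
      refine le_iInf fun S => ?_
      rcases hFle n S with hA | hB
      · rw [hn, top_le_iff] at hA
        rw [hA, ENNReal.top_rpow_of_pos (by positivity), top_add]
        exact le_top
      · refine le_trans ?_ le_add_self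
        rw [ENNReal.ofReal_mul hs.le]
        gcongr
    have hS : ∑' u, b u ^ Q = ∞ := by
      by_contra hcon
      refine absurd hup1 (not_le.2 ?_)
      refine lt_of_lt_of_le (ENNReal.mul_ne_top hCk hcon).lt_top ?_
      refine le_trans ?_ (ENNReal.le_tsum n)
      rw [hn, ENNReal.mul_top]
      have : (0 : ℝ) < (2 : ℝ) ^ (-(n : ℝ) * σ) := by positivity
      simpa using this
    rw [hJ, hS, ENNReal.mul_top (by simp), ENNReal.mul_top (by simp)]
    exact ⟨le_rfl, le_rfl⟩
  set Φ : ℤ → ℝ := fun n => (F n).toReal with hΦ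
  have hΦ0 : ∀ n, 0 ≤ Φ n := fun n => ENNReal.toReal_nonneg
  have hFΦ : ∀ n, F n = ENNReal.ofReal (Φ n) := fun n => (ENNReal.ofReal_toReal (hFfin n)).symm
  have hΦ1 : ∀ n, Φ n ≤ Φ (n + 1) := by
    intro n
    refine ENNReal.toReal_mono (hFfin _) (ENNReal.tsum_le_tsum fun u => ?_)
    have h1 : ENNReal.ofReal (m (n + 1)) ≤ ENNReal.ofReal (m n) :=
      ENNReal.ofReal_le_ofReal (by linarith [hm1 n, hm0 (n + 1)])
    split_ifs with h2 h3 h3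
    · exact le_rfl
    · exact absurd (h1.trans_lt h2) h3
    · exact bot_le
    · exact le_rfl
  set t : ℤ → ℝ := fun n => Φ n ^ p₀⁻¹ / m n with ht
  have ht0 : ∀ n, 0 ≤ t n := fun n => by
    have := hΦ0 n; have := hm0 n
    simp only [ht]; positivity
  have htm : ∀ n, t n * m n = Φ n ^ p₀⁻¹ := fun n => by
    simp only [ht]; exact div_mul_cancel₀ _ (hm0 n).ne'
  have htr : ∀ n, 2 * t n ≤ t (n + 1) := by
    intro n
    have a1 := hm0 (n + 1)
    have a2 := hΦ1 n
    have a3 := hΦ0 n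
    simp only [ht]
    rw [hm1 n, show 2 * (Φ n ^ p₀⁻¹ / (2 * m (n + 1))) = Φ n ^ p₀⁻¹ / m (n + 1) by field_simp]
    gcongr
  have hex : ∃ n, 0 < t n := by
    by_contra hcon
    push Not at hcon
    have hF0 : ∀ n, F n = 0 := by
      intro n
      have h1 : t n = 0 := le_antisymm (hcon n) (ht0 n)
      have h2 := htm n
      rw [h1, zero_mul] at h2
      have h3 : Φ n = 0 := by
        by_contra h4
        have : 0 < Φ n := lt_of_le_of_ne (hΦ0 n) (Ne.symm h4)
        have : 0 < Φ n ^ p₀⁻¹ := by positivity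
        linarith
      rw [hFΦ, h3, ENNReal.ofReal_zero]
    simp only [hF0, mul_zero, tsum_zero, nonpos_iff_eq_zero] at hlow1
    obtain ⟨u, hu⟩ := hbne
    exact (ENNReal.rpow_pos (pos_iff_ne_zero.2 hu) (hb u)).ne' (ENNReal.tsum_eq_zero.1 hlow1 u)
  have hKlow : ∀ n s, t n ≤ s → ENNReal.ofReal (1 * (t n * m n)) ≤ K b s := by
    intro n s hs
    have a3 := hm0 n
    have hs0 : 0 ≤ s := (ht0 n).trans hs
    rw [hKdef, one_mul]
    refine le_iInf fun S => ?_
    rcases hFle n S with hA | hB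
    · refine le_trans ?_ le_self_add
      rw [hFΦ] at hA
      refine le_trans ?_ (ENNReal.rpow_le_rpow hA (by positivity))
      rw [ENNReal.ofReal_rpow_of_nonneg (hΦ0 n) (by positivity), htm]
    · refine le_trans ?_ le_add_self
      refine le_trans ?_ (mul_le_mul_right hB _)
      rw [← ENNReal.ofReal_mul hs0]
      apply ENNReal.ofReal_le_ofReal
      gcongr
  have hKup : ∀ n s, t n < s → K b s ≤ ENNReal.ofReal (2 * m n * s) := by
    intro n s hs
    have a0 := hΦ0 n
    have a3 := hm0 n
    have a4 := ht0 n
    have hs0 : 0 < s := a4.trans_lt hs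
    rw [hKdef]
    set S : Set ι := {u | ENNReal.ofReal (m n) < b u} with hS
    refine (iInf_le _ S).trans ?_
    have hA : ∑' u, S.indicator b u ^ p₀ ≤ ENNReal.ofReal (Φ n) := by
      rw [← hFΦ]
      refine ENNReal.tsum_le_tsum fun u => ?_
      by_cases hu : u ∈ S
      · rw [Set.indicator_of_mem hu]
        exact (if_pos (show ENNReal.ofReal (m n) < b u from hu)).ge
      · rw [Set.indicator_of_notMem hu, ENNReal.zero_rpow_of_pos hp₀]; exact bot_le
    have hB : ⨆ u, Sᶜ.indicator b u ≤ ENNReal.ofReal (m n) := by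
      refine iSup_le fun u => ?_
      by_cases hu : u ∈ S
      · rw [Set.indicator_of_notMem (by simpa using hu)]
        exact bot_le
      · rw [Set.indicator_of_mem (s := Sᶜ) hu]
        exact not_lt.1 hu
    calc _ ≤ ENNReal.ofReal (Φ n) ^ p₀⁻¹ + ENNReal.ofReal s * ENNReal.ofReal (m n) := by gcongr
      _ = ENNReal.ofReal (t n * m n + s * m n) := by
          rw [ENNReal.ofReal_rpow_of_nonneg a0 (by positivity),
            ← ENNReal.ofReal_mul hs0.le, ← ENNReal.ofReal_add (by positivity) (by positivity), htm]
      _ ≤ _ := by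
          apply ENNReal.ofReal_le_ofReal
          nlinarith
  have hsum : ∑' n, ENNReal.ofReal (t n ^ ((1 - θ) * Q) * m n ^ Q)
      = ∑' n : ℤ, ENNReal.ofReal ((2 : ℝ) ^ (-(n : ℝ) * σ)) * F n := by
    congr 1; ext n
    rw [hFΦ, ← ENNReal.ofReal_mul (by positivity)]
    congr 1
    have a0 := hΦ0 n
    have a3 := hm0 n
    simp only [ht]
    rw [Real.div_rpow (by positivity) a3.le, ← Real.rpow_mul a0, ← hpQ,
      inv_mul_cancel₀ hp₀.ne', Real.rpow_one, show Q = p₀ + σ by rw [hpQ, hσ]; ring,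
      Real.rpow_add a3]
    rw [show (2 : ℝ) ^ (-(n : ℝ) * σ) = m n ^ σ by
      simp only [hm]; rw [← Real.rpow_mul (by norm_num)]]
    field_simp
  constructor
  · calc ∑' u, b u ^ Q ≤ ENNReal.ofReal (2 ^ σ) *
          ∑' n, ENNReal.ofReal (t n ^ ((1 - θ) * Q) * m n ^ Q) := by rw [hsum]; exact hlow1
      _ ≤ ENNReal.ofReal (2 ^ σ) * (Cl * ∫⁻ s in Ioi (0 : ℝ), itg (K b) θ Q s) :=
          mul_le_mul_right (hlow (K b) t m ht0 hm0 htr hKlow) _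
      _ = (ENNReal.ofReal (2 ^ σ) * Cl) * ∫⁻ s in Ioi (0 : ℝ), itg (K b) θ Q s := by
          rw [mul_assoc]
      _ ≤ _ := mul_le_mul_left le_self_add _
  · calc _ ≤ Cu * ∑' n, ENNReal.ofReal (t n ^ ((1 - θ) * Q) * m n ^ Q) :=
          hupp (K b) t m ht0 hm0 htr hex (fun n => (hm1 n).le) hKup
      _ ≤ Cu * (Ck * ∑' u, b u ^ Q) := by
          rw [hsum]
          exact mul_le_mul_right hup1 _
      _ = (Cu * Ck) * ∑' u, b u ^ Q := by rw [mul_assoc]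
      _ ≤ _ := mul_le_mul_left le_self_add _


lemma seqK_symm {ι : Type*} (q₀ q₁ : ℝ≥0∞) (b : ι → ℝ≥0∞) {t : ℝ} (ht : 0 < t) :
    seqK q₀ q₁ b t = ENNReal.ofReal t * seqK q₁ q₀ b t⁻¹ := by
  have ht0 : ENNReal.ofReal t ≠ 0 := by simpa using ht
  unfold seqK
  rw [ENNReal.mul_iInf_of_ne ht0 ENNReal.ofReal_ne_top]
  rw [← (compl_surjective (α := Set ι)).iInf_comp]
  refine iInf_congr fun S => ?_
  have e : ENNReal.ofReal t * ENNReal.ofReal t⁻¹ = 1 := by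
    rw [← ENNReal.ofReal_mul ht.le, mul_inv_cancel₀ ht.ne', ENNReal.ofReal_one]
  simp only [compl_compl]
  rw [mul_add, ← mul_assoc, e, one_mul, add_comm]

lemma interpOf_symm {ι : Type*} (q₀ q₁ q : ℝ≥0∞) (hq : q ≠ ∞) (θ : ℝ) (b : ι → ℝ≥0∞) :
    interpOf (seqK q₀ q₁ b) θ q = interpOf (seqK q₁ q₀ b) (1 - θ) q := by
  unfold interpOf
  rw [if_neg hq, if_neg hq]
  congr 1
  rw [lintegral_Ioi_inv]
  refine setLIntegral_congr_fun measurableSet_Ioi fun t ht => ?_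
  have ht : 0 < t := ht
  show (ENNReal.ofReal (t⁻¹ ^ (-θ)) * seqK q₀ q₁ b t⁻¹) ^ q.toReal / ENNReal.ofReal t = (ENNReal.ofReal (t ^ (-(1 - θ))) * seqK q₁ q₀ b t) ^ q.toReal / ENNReal.ofReal t
  rw [seqK_symm q₀ q₁ b (inv_pos.2 ht), inv_inv, ← mul_assoc,
    ← ENNReal.ofReal_mul (by positivity)]
  congr 4
  rw [Real.inv_rpow ht.le, Real.rpow_neg ht.le, inv_inv, ← Real.rpow_neg_one t,
    ← Real.rpow_add ht]
  congr 1; ring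

lemma seqNorm_zero' {ι : Type*} (q : ℝ≥0∞) (hq : 0 < q) (b : ι → ℝ≥0∞) (hb : ∀ u, b u = 0) :
    seqNorm q b = 0 := by
  unfold seqNorm
  split_ifs with h
  · simp [hb]
  · have h0 : 0 < q.toReal := ENNReal.toReal_pos hq.ne' h
    simp [hb, h0]

lemma seqK_le_left {ι : Type*} (q₀ q₁ : ℝ≥0∞) (hq₁ : 0 < q₁) (b : ι → ℝ≥0∞) (t : ℝ) :
    seqK q₀ q₁ b t ≤ seqNorm q₀ b := by
  refine (iInf_le _ Set.univ).trans ?_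
  rw [Set.indicator_univ, seqNorm_zero' q₁ hq₁ _ (by simp), mul_zero, add_zero]

lemma seqK_le_right {ι : Type*} (q₀ q₁ : ℝ≥0∞) (hq₀ : 0 < q₀) (b : ι → ℝ≥0∞) (t : ℝ) :
    seqK q₀ q₁ b t ≤ ENNReal.ofReal t * seqNorm q₁ b := by
  refine (iInf_le _ ∅).trans ?_
  rw [Set.compl_empty, Set.indicator_univ, seqNorm_zero' q₀ hq₀ _ (by simp), zero_add]

lemma interpOf_zero (K : ℝ → ℝ≥0∞) (hK : ∀ t, K t = 0) (θ : ℝ) (q : ℝ≥0∞) (hq : 0 < q) :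
    interpOf K θ q = 0 := by
  unfold interpOf
  split_ifs with h
  · simp [hK]
  · have h0 : 0 < q.toReal := ENNReal.toReal_pos hq.ne' h
    simp [hK, h0]

/-- Passing from the integrated estimate to the norms. -/
lemma scalar_root {ι : Type*} (q₀ q₁ q : ℝ≥0∞) (hq₁ : 0 < q₁) (hq₀ : 0 < q₀)
    (hq : 0 < q) (hqt : q ≠ ∞) (θ : ℝ)
    (H : ∃ C₁ C₂ : ℝ≥0∞, C₁ ≠ ∞ ∧ C₂ ≠ ∞ ∧ ∀ b : ι → ℝ≥0∞, (∀ u, b u ≠ ∞) → (∃ u, b u ≠ 0) →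
      seqK q₀ q₁ b 1 ≠ ∞ →
      ∑' u, b u ^ q.toReal ≤ C₁ * ∫⁻ s in Ioi (0 : ℝ), itg (seqK q₀ q₁ b) θ q.toReal s ∧
      ∫⁻ s in Ioi (0 : ℝ), itg (seqK q₀ q₁ b) θ q.toReal s ≤ C₂ * ∑' u, b u ^ q.toReal) :
    ∃ C₁ C₂ : ℝ≥0∞, C₁ ≠ ∞ ∧ C₂ ≠ ∞ ∧ ∀ b : ι → ℝ≥0∞, (∀ u, b u ≠ ∞) →
      seqK q₀ q₁ b 1 ≠ ∞ →
      seqNorm q b ≤ C₁ * interpOf (seqK q₀ q₁ b) θ q ∧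
      interpOf (seqK q₀ q₁ b) θ q ≤ C₂ * seqNorm q b := by
  obtain ⟨C₁, C₂, h₁, h₂, H⟩ := H
  have h0 : 0 < q.toReal := ENNReal.toReal_pos hq.ne' hqt
  have hi : 0 ≤ q.toReal⁻¹ := by positivity
  refine ⟨C₁ ^ q.toReal⁻¹, C₂ ^ q.toReal⁻¹, ENNReal.rpow_ne_top_of_nonneg hi h₁,
    ENNReal.rpow_ne_top_of_nonneg hi h₂, fun b hb hK => ?_⟩
  by_cases hne : ∃ u, b u ≠ 0
  · obtain ⟨A, B⟩ := H b hb hne hK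
    unfold seqNorm interpOf
    rw [if_neg hqt, if_neg hqt, ← ENNReal.mul_rpow_of_nonneg _ _ hi,
      ← ENNReal.mul_rpow_of_nonneg _ _ hi]
    exact ⟨ENNReal.rpow_le_rpow A hi, ENNReal.rpow_le_rpow B hi⟩
  · push Not at hne
    rw [seqNorm_zero' q hq b hne, interpOf_zero _ _ _ _ hq]
    · simp
    · intro t
      exact le_antisymm ((seqK_le_left q₀ q₁ hq₁ b t).trans
        (seqNorm_zero' q₀ hq₀ b hne).le) bot_le

lemma scalar_fin {ι : Type*} {θ : ℝ} (hθ0 : 0 < θ) (hθ1 : θ < 1) (q₀ q₁ q : ℝ≥0∞)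
    (hq₀ : 0 < q₀) (hq₁ : 0 < q₁) (hq : 0 < q) (hqt : q ≠ ∞) (h₀ : q₀ ≠ ∞)
    (h : q.toReal⁻¹ = (1 - θ) * q₀.toReal⁻¹ + θ * q₁.toReal⁻¹) :
    ∃ C₁ C₂ : ℝ≥0∞, C₁ ≠ ∞ ∧ C₂ ≠ ∞ ∧ ∀ b : ι → ℝ≥0∞, (∀ u, b u ≠ ∞) →
      seqK q₀ q₁ b 1 ≠ ∞ →
      seqNorm q b ≤ C₁ * interpOf (seqK q₀ q₁ b) θ q ∧
      interpOf (seqK q₀ q₁ b) θ q ≤ C₂ * seqNorm q b := by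
  refine scalar_root q₀ q₁ q hq₁ hq₀ hq hqt θ ?_
  have Q0 : 0 < q.toReal := ENNReal.toReal_pos hq.ne' hqt
  have P0 : 0 < q₀.toReal := ENNReal.toReal_pos hq₀.ne' h₀
  by_cases h₁ : q₁ = ∞
  · subst h₁
    obtain ⟨C₁, C₂, a, b, H⟩ := scalar_inf_int (ι := ι) hθ0 hθ1 P0 Q0 (by simpa using h)
      (seqK q₀ ∞) (by
        intro b t
        unfold seqK seqNorm
        simp only [if_neg h₀, if_true])
    exact ⟨C₁, C₂, a, b, fun c hc hn _ => H c hc hn⟩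
  · have P1 : 0 < q₁.toReal := ENNReal.toReal_pos hq₁.ne' h₁
    exact scalar_fin_int (ι := ι) hθ0 hθ1 P0 P1 Q0 h
      (seqK q₀ q₁) (by
        intro b t
        unfold seqK seqNorm
        simp only [if_neg h₀, if_neg h₁])

lemma scalar_main {ι : Type*} {θ : ℝ} (hθ0 : 0 < θ) (hθ1 : θ < 1) (q₀ q₁ q : ℝ≥0∞)
    (hq₀ : 0 < q₀) (hq₁ : 0 < q₁) (hq : 0 < q)
    (h : q⁻¹ = ENNReal.ofReal (1 - θ) * q₀⁻¹ + ENNReal.ofReal θ * q₁⁻¹) :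
    ∃ C₁ C₂ : ℝ≥0∞, C₁ ≠ ∞ ∧ C₂ ≠ ∞ ∧ ∀ b : ι → ℝ≥0∞, (∀ u, b u ≠ ∞) →
      seqK q₀ q₁ b 1 ≠ ∞ →
      seqNorm q b ≤ C₁ * interpOf (seqK q₀ q₁ b) θ q ∧
      interpOf (seqK q₀ q₁ b) θ q ≤ C₂ * seqNorm q b := by
  have hθ1' : 0 < 1 - θ := by linarith
  have hreal : q.toReal⁻¹ = (1 - θ) * q₀.toReal⁻¹ + θ * q₁.toReal⁻¹ := by
    have := congrArg ENNReal.toReal h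
    rw [ENNReal.toReal_add (ENNReal.mul_ne_top ENNReal.ofReal_ne_top (by simpa using hq₀.ne'))
      (ENNReal.mul_ne_top ENNReal.ofReal_ne_top (by simpa using hq₁.ne')),
      ENNReal.toReal_mul, ENNReal.toReal_mul, ENNReal.toReal_ofReal hθ0.le,
      ENNReal.toReal_ofReal hθ1'.le, ENNReal.toReal_inv, ENNReal.toReal_inv,
      ENNReal.toReal_inv] at this
    exact this
  by_cases h₀ : q₀ = ∞
  · by_cases h₁ : q₁ = ∞
    · subst h₀ h₁
      have hqt : q = ∞ := by simpa using h
      subst hqt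
      refine ⟨1, 1, by simp, by simp, fun b _ _ => ⟨?_, ?_⟩⟩
      · rw [one_mul]
        have e : interpOf (seqK ∞ ∞ b) θ ∞
            = ⨆ t : {t : ℝ // 0 < t}, ENNReal.ofReal (t.1 ^ (-θ)) * seqK ∞ ∞ b t.1 := by
          simp [interpOf]
        rw [e]
        refine le_trans ?_ (le_iSup _ (⟨1, one_pos⟩ : {t : ℝ // 0 < t}))
        simp only [Real.one_rpow, ENNReal.ofReal_one, one_mul]
        refine le_iInf fun S => ?_
        rw [ENNReal.ofReal_one, one_mul]
        have e1 : seqNorm ∞ b = ⨆ u, b u := by simp [seqNorm]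
        rw [e1]
        refine iSup_le fun u => ?_
        by_cases hu : u ∈ S
        · refine le_trans ?_ le_self_add
          refine le_trans ?_ (le_seqNorm ∞ hq₀ _ u)
          rw [Set.indicator_of_mem hu]
        · refine le_trans ?_ le_add_self
          refine le_trans ?_ (le_seqNorm ∞ hq₀ _ u)
          rw [Set.indicator_of_mem (s := Sᶜ) hu]
      · rw [one_mul]
        unfold interpOf
        rw [if_pos rfl]
        refine iSup_le fun ⟨t, ht⟩ => ?_
        simp only
        rcases le_total 1 t with h1 | h1
        · calc _ ≤ 1 * seqNorm ∞ b := by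
                refine mul_le_mul' ?_ (seqK_le_left _ _ hq₁ b t)
                rw [← ENNReal.ofReal_one]
                exact ENNReal.ofReal_le_ofReal
                  (Real.rpow_le_one_of_one_le_of_nonpos h1 (by linarith))
            _ = _ := one_mul _
        · calc _ ≤ ENNReal.ofReal (t ^ (-θ)) * (ENNReal.ofReal t * seqNorm ∞ b) := by
                gcongr
                exact seqK_le_right _ _ hq₁ b t
            _ ≤ 1 * seqNorm ∞ b := by
                rw [← mul_assoc, ← ENNReal.ofReal_mul (by positivity)]
                gcongr
                rw [← ENNReal.ofReal_one]
                refine ENNReal.ofReal_le_ofReal ?_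
                rw [← Real.rpow_add_one ht.ne']
                exact Real.rpow_le_one ht.le h1 (by linarith)
            _ = _ := one_mul _
    · have hqt : q ≠ ∞ := by
        rintro rfl
        subst h₀
        simp at h
        rcases h with h | h
        · linarith
        · exact h₁ h
      obtain ⟨C₁, C₂, a, b, H⟩ := scalar_fin (ι := ι) hθ1' (by linarith) q₁ q₀ q hq₁ hq₀ hq hqt
        h₁ (by rw [hreal]; ring)
      refine ⟨C₁, C₂, a, b, fun c hc hK => ?_⟩
      rw [interpOf_symm q₀ q₁ q hqt]
      refine H c hc ?_
      rw [seqK_symm q₀ q₁ c one_pos] at hK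
      simpa using hK
  · have hqt : q ≠ ∞ := by
      rintro rfl
      rw [ENNReal.inv_top, eq_comm, add_eq_zero, mul_eq_zero, ENNReal.ofReal_eq_zero,
        ENNReal.inv_eq_zero] at h
      rcases h.1 with h | h
      · linarith
      · exact h₀ h
    exact scalar_fin hθ0 hθ1 q₀ q₁ q hq₀ hq₁ hq hqt h₀ hreal

/-- (Real interpolation, same weight.) Let `0 < θ < 1`, `a ∈ ℝ`,
`0 < p < ∞`, `0 < q₀, q₁, r ≤ ∞` and `1/q = (1−θ)/q₀ + θ/q₁`.  Then
`(HL^{a,r}_{p,q₀}, HL^{a,r}_{p,q₁})_{θ,q} = HL^{a,r}_{p,q}` with equivalent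
quasi-norms on `X₀ + X₁`. -/
theorem lorentzHerz_interp_outer {N : ℕ} (hN : 1 ≤ N)
    (Ω : Set (Euc N)) (hΩ : MeasurableSet Ω)
    (θ : ℝ) (hθ0 : 0 < θ) (hθ1 : θ < 1) (a : ℝ)
    (p q₀ q₁ q r : ℝ≥0∞) (hp0 : 0 < p) (hp : p ≠ ∞)
    (hq₀ : 0 < q₀) (hq₁ : 0 < q₁) (hr : 0 < r)
    (hq : q⁻¹ = ENNReal.ofReal (1 - θ) * q₀⁻¹ + ENNReal.ofReal θ * q₁⁻¹) :
    ∃ c C : ℝ≥0∞, 0 < c ∧ C < ∞ ∧ ∀ f : Euc N → ℝ, Measurable f →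
      inSum (herzNorm volume Ω a p q₀ r) (herzNorm volume Ω a p q₁ r) f →
      c * herzNorm volume Ω a p q r f
          ≤ interpNorm (herzNorm volume Ω a p q₀ r) (herzNorm volume Ω a p q₁ r) θ q f
      ∧ interpNorm (herzNorm volume Ω a p q₀ r) (herzNorm volume Ω a p q₁ r) θ q f
          ≤ C * herzNorm volume Ω a p q r f := by
  have hq' : 0 < q := by
    rw [pos_iff_ne_zero]
    rintro rfl
    rw [ENNReal.inv_zero] at hq
    exact (ENNReal.add_ne_top.2
      ⟨ENNReal.mul_ne_top ENNReal.ofReal_ne_top (by simpa using hq₀.ne'),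
        ENNReal.mul_ne_top ENNReal.ofReal_ne_top (by simpa using hq₁.ne')⟩) hq.symm
  obtain ⟨C₁, C₂, h₁, h₂, H⟩ := scalar_main (ι := {u : ℤ // -1 ≤ u}) hθ0 hθ1 q₀ q₁ q hq₀ hq₁ hq' hq
  obtain ⟨κ, hκ, hκ0, Hκ⟩ := seqK_le_Kfun Ω a p q₀ q₁ r hq₀ hq₁ hr
  have hfin : C₁ * κ + 1 ≠ ∞ := ENNReal.add_ne_top.2 ⟨ENNReal.mul_ne_top h₁ hκ, by simp⟩
  refine ⟨(C₁ * κ + 1)⁻¹, C₂, ENNReal.inv_pos.2 hfin, h₂.lt_top, fun f hf hs => ?_⟩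
  have hK1 : seqK q₀ q₁ (blk Ω a p r f) 1 ≠ ∞ := by
    obtain ⟨g, hg, hfg, hn0, hn1⟩ := hs
    refine ne_top_of_le_ne_top ?_ (Hκ f 1)
    refine ENNReal.mul_ne_top hκ ?_
    have hle : Kfun (herzNorm volume Ω a p q₀ r) (herzNorm volume Ω a p q₁ r) 1 f
        ≤ herzNorm volume Ω a p q₀ r g
          + ENNReal.ofReal 1 * herzNorm volume Ω a p q₁ r (f - g) :=
      iInf_le_of_le g (iInf_le_of_le hg (iInf_le _ hfg))
    refine ne_top_of_le_ne_top ?_ hle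
    exact ENNReal.add_ne_top.2 ⟨hn0.ne, ENNReal.mul_ne_top ENNReal.ofReal_ne_top hn1.ne⟩
  have hb : ∀ u, blk Ω a p r f u ≠ ∞ := by
    intro u
    obtain ⟨S, hS⟩ := iInf_lt_iff.1 (lt_top_iff_ne_top.2 hK1)
    rw [ENNReal.ofReal_one, one_mul, ENNReal.add_lt_top] at hS
    by_cases hu : u ∈ S
    · have := (le_seqNorm q₀ hq₀ (S.indicator (blk Ω a p r f)) u).trans_lt hS.1
      rw [Set.indicator_of_mem hu] at this
      exact this.ne
    · have := (le_seqNorm q₁ hq₁ (Sᶜ.indicator (blk Ω a p r f)) u).trans_lt hS.2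
      rw [Set.indicator_of_mem (s := Sᶜ) hu] at this
      exact this.ne
  obtain ⟨HA, HB⟩ := H _ hb hK1
  rw [herzNorm_eq, interpNorm_eq]
  constructor
  · have hI : interpOf (seqK q₀ q₁ (blk Ω a p r f)) θ q ≤ κ * interpOf (fun t =>
        Kfun (herzNorm volume Ω a p q₀ r) (herzNorm volume Ω a p q₁ r) t f) θ q := by
      rw [← interpOf_const_mul _ _ _ hq' _ hκ]
      exact interpOf_mono θ q fun t _ => Hκ f t
    rw [ENNReal.inv_mul_le_iff (by simp) hfin]
    calc _ ≤ C₁ * interpOf (seqK q₀ q₁ (blk Ω a p r f)) θ q := HA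
      _ ≤ C₁ * (κ * _) := mul_le_mul_right hI _
      _ = C₁ * κ * _ := (mul_assoc _ _ _).symm
      _ ≤ _ := mul_le_mul_left le_self_add _
  · exact (interpOf_mono θ q fun t _ => Kfun_le_seqK hΩ a p q₀ q₁ r hr f hf t).trans HB
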